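/- Let X be a locally finite systolic simplicial complex and let k ≥ 2 be a natural number. Then the condition Conn_k^∞(X) holds: for every compact subset K of X there exists a compact subset L of X with K ⊆ L such that every continuous map from the k-sphere S^k into X∖L extends to a continuous map of the (k+1)-ball B^{k+1} into X∖K. -/

import Mathlib

universe u

/-- An abstract simplicial complex on a vertex type `V`: a downward-closed
family of nonempty finite subsets of `V`. -/
structure SComplex (V : Type u) where
  faces : Set (Finset V)
  nonempty_of_mem : ∀ σ ∈ faces, σ.Nonempty
  down_closed : ∀ σ ∈ faces, ∀ τ : Finset V, τ ⊆ σ → τ.Nonempty → τ ∈ faces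

namespace SComplex

variable {V : Type u} [DecidableEq V]

/-- The vertex set of a simplicial complex. -/
def vertexSet (X : SComplex V) : Set V := {v | ({v} : Finset V) ∈ X.faces}

/-- The geometric realization of a simplicial complex: the set of barycentric
coordinate functions supported on a simplex, inside the product space `V → ℝ`. -/
def realization (X : SComplex V) : Set (V → ℝ) :=
  {f | (∀ v, 0 ≤ f v) ∧ ∃ σ ∈ X.faces, (∀ v, v ∉ σ → f v = 0) ∧ ∑ v ∈ σ, f v = 1}

/-- `Y` is a subcomplex of `X`. -/
def IsSubcomplexOf (Y X : SComplex V) : Prop := Y.faces ⊆ X.faces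

/-- `Y` is a full subcomplex of `X`. -/
def IsFullSubcomplexOf (Y X : SComplex V) : Prop :=
  Y.faces ⊆ X.faces ∧
    ∀ σ ∈ X.faces, (∀ v ∈ σ, ({v} : Finset V) ∈ Y.faces) → σ ∈ Y.faces

/-- The full subcomplex of `X` spanned by a set `W` of vertices. -/
def restrict (X : SComplex V) (W : Set V) : SComplex V where
  faces := {σ | σ ∈ X.faces ∧ ∀ v ∈ σ, v ∈ W}
  nonempty_of_mem := fun σ h => X.nonempty_of_mem σ h.1
  down_closed := fun σ h τ hτ hne =>
    ⟨X.down_closed σ h.1 τ hτ hne, fun v hv => h.2 v (hτ hv)⟩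

/-- The link of a simplex `σ` in `X`. -/
def link (X : SComplex V) (σ : Finset V) : SComplex V where
  faces := {τ | τ ∈ X.faces ∧ Disjoint τ σ ∧ τ ∪ σ ∈ X.faces}
  nonempty_of_mem := fun τ h => X.nonempty_of_mem τ h.1
  down_closed := by
    rintro τ ⟨hτ, hdisj, hunion⟩ ρ hρ hne
    refine ⟨X.down_closed τ hτ ρ hρ hne, ?_, ?_⟩
    · exact Finset.disjoint_left.mpr fun a ha hb => Finset.disjoint_left.mp hdisj (hρ ha) hb
    · exact X.down_closed _ hunion _ (Finset.union_subset_union hρ (subset_refl σ))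
        (hne.mono Finset.subset_union_left)

/-- A combinatorial cycle of length `m` in `X` (a subcomplex homeomorphic to a circle):
an injective enumeration of `m` vertices, consecutive ones joined by edges of `X`. -/
def IsCycle (X : SComplex V) (m : ℕ) (γ : ZMod m → V) : Prop :=
  3 ≤ m ∧ Function.Injective γ ∧ ∀ i : ZMod m, ({γ i, γ (i + 1)} : Finset V) ∈ X.faces

/-- The cycle `γ` has a diagonal: an edge of `X` joining two nonconsecutive vertices. -/
def HasDiagonal (X : SComplex V) (m : ℕ) (γ : ZMod m → V) : Prop :=
  ∃ i j : ZMod m, j ≠ i ∧ j ≠ i + 1 ∧ j ≠ i - 1 ∧ ({γ i, γ j} : Finset V) ∈ X.faces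

/-- A simplicial complex is flag if every finite set of vertices pairwise joined
by edges spans a simplex. -/
def Flag (X : SComplex V) : Prop :=
  ∀ A : Finset V, A.Nonempty → (∀ v ∈ A, ({v} : Finset V) ∈ X.faces) →
    (∀ v ∈ A, ∀ w ∈ A, v ≠ w → ({v, w} : Finset V) ∈ X.faces) → A ∈ X.faces

/-- A simplicial complex is `k`-large if it is flag and every cycle of length
`4 ≤ |γ| < k` has a diagonal. -/
def KLarge (k : ℕ) (X : SComplex V) : Prop :=
  X.Flag ∧ ∀ (m : ℕ) (γ : ZMod m → V), X.IsCycle m γ → 4 ≤ m → m < k → X.HasDiagonal m γ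

/-- A simplicial complex is locally `k`-large if all links of its (nonempty) simplices
are `k`-large. -/
def LocallyKLarge (k : ℕ) (X : SComplex V) : Prop :=
  ∀ σ ∈ X.faces, KLarge k (X.link σ)

/-- A systolic complex: connected, simply connected and locally `6`-large. -/
def Systolic (X : SComplex V) : Prop :=
  LocallyKLarge 6 X ∧ ConnectedSpace X.realization ∧ SimplyConnectedSpace X.realization

/-- A simplicial complex is locally finite if every vertex belongs to finitely
many simplices. -/
def LocallyFinite (X : SComplex V) : Prop :=
  ∀ v : V, {σ ∈ X.faces | v ∈ σ}.Finite

/-- The faces of the closed combinatorial ball of radius `i` around the simplex `σ`: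
`B_0 = σ` and `B_{i+1}` is the union of all closed simplices meeting `B_i`. -/
def ballFaces (X : SComplex V) (σ : Finset V) : ℕ → Set (Finset V)
  | 0 => {τ | τ ∈ X.faces ∧ τ ⊆ σ}
  | i + 1 => {ρ | ρ ∈ X.faces ∧ ∃ τ ∈ X.faces, ρ ⊆ τ ∧
      ∃ v ∈ τ, ({v} : Finset V) ∈ X.ballFaces σ i}

/-- The closed combinatorial ball of radius `i` around `σ`, as a subcomplex. -/
def ball (X : SComplex V) (σ : Finset V) (i : ℕ) : SComplex V where
  faces := X.ballFaces σ i
  nonempty_of_mem := by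
    cases i with
    | zero => exact fun τ h => X.nonempty_of_mem τ h.1
    | succ n => exact fun τ h => X.nonempty_of_mem τ h.1
  down_closed := by
    cases i with
    | zero => exact fun τ h ρ hsub hne =>
        ⟨X.down_closed τ h.1 ρ hsub hne, hsub.trans h.2⟩
    | succ n =>
        rintro τ ⟨hτ, μ, hμ, hsub2, v, hv, hball⟩ ρ hsub hne
        exact ⟨X.down_closed τ hτ ρ hsub hne, μ, hμ, hsub.trans hsub2, v, hv, hball⟩

/-- The faces of the combinatorial sphere of radius `i` around `σ`: the faces of the
ball `B_i` all of whose vertices are at combinatorial distance exactly `i` from `σ`. -/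
def sphereFaces (X : SComplex V) (σ : Finset V) : ℕ → Set (Finset V)
  | 0 => X.ballFaces σ 0
  | i + 1 => {τ | τ ∈ X.ballFaces σ (i + 1) ∧
      ∀ v ∈ τ, ({v} : Finset V) ∉ X.ballFaces σ i}

/-- The combinatorial sphere of radius `i` around `σ`, as a subcomplex: the subcomplex
of `B_i` spanned by the vertices at combinatorial distance `i` from `σ`. -/
def sphere (X : SComplex V) (σ : Finset V) (i : ℕ) : SComplex V where
  faces := X.sphereFaces σ i
  nonempty_of_mem := by
    cases i with
    | zero => exact fun τ h => (X.ball σ 0).nonempty_of_mem τ h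
    | succ n => exact fun τ h => (X.ball σ (n + 1)).nonempty_of_mem τ h.1
  down_closed := by
    cases i with
    | zero => exact fun τ h ρ hsub hne => (X.ball σ 0).down_closed τ h ρ hsub hne
    | succ n =>
        rintro τ ⟨hτ, hout⟩ ρ hsub hne
        exact ⟨(X.ball σ (n + 1)).down_closed τ hτ ρ hsub hne,
          fun v hv => hout v (hsub hv)⟩

/-- The condition `R(v,X)`: for every simplex `σ` of the link `X_v`, the complement
in `X_v` of the open combinatorial ball of radius `2` around `σ` (i.e. the full
subcomplex of `X_v` spanned by the vertices at combinatorial distance at least `2`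
from `σ`) is connected. -/
def CondR (X : SComplex V) (v : V) : Prop :=
  ∀ σ ∈ (X.link {v}).faces,
    ConnectedSpace
      ((X.link {v}).restrict
        {w | ({w} : Finset V) ∉ (X.link {v}).ballFaces σ 1}).realization

/-- A chamber complex of dimension `n`: every simplex is contained in a simplex with
`n+1` vertices (a chamber), there are no larger simplices, and every codimension-one
face lies in at least two chambers. -/
def IsChamberComplex (X : SComplex V) (n : ℕ) : Prop :=
  (∀ σ ∈ X.faces, σ.card ≤ n + 1) ∧
  (∀ σ ∈ X.faces, ∃ τ ∈ X.faces, σ ⊆ τ ∧ τ.card = n + 1) ∧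
  (∀ σ ∈ X.faces, σ.card = n →
    ∃ τ₁ ∈ X.faces, ∃ τ₂ ∈ X.faces, τ₁ ≠ τ₂ ∧ σ ⊆ τ₁ ∧ σ ⊆ τ₂ ∧
      τ₁.card = n + 1 ∧ τ₂.card = n + 1)

/-- Two chambers of an `n`-dimensional chamber complex are adjacent if they share a
codimension-one face. -/
def ChamberAdj (X : SComplex V) (n : ℕ) (σ τ : Finset V) : Prop :=
  σ ∈ X.faces ∧ τ ∈ X.faces ∧ σ.card = n + 1 ∧ τ.card = n + 1 ∧
    ∃ ρ ∈ X.faces, ρ.card = n ∧ ρ ⊆ σ ∧ ρ ⊆ τ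

/-- A chamber complex is gallery connected if any two chambers are joined by a gallery. -/
def GalleryConnected (X : SComplex V) (n : ℕ) : Prop :=
  ∀ σ ∈ X.faces, σ.card = n + 1 → ∀ τ ∈ X.faces, τ.card = n + 1 →
    Relation.ReflTransGen (X.ChamberAdj n) σ τ

/-- A normal chamber complex: gallery connected, with all links of dimension above `0`
gallery connected. -/
def IsNormalChamberComplex (X : SComplex V) (n : ℕ) : Prop :=
  IsChamberComplex X n ∧ GalleryConnected X n ∧
    ∀ σ ∈ X.faces, σ.card ≤ n - 1 → GalleryConnected (X.link σ) (n - σ.card)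

/-- A pseudomanifold of dimension `n`: a chamber complex in which every codimension-one
face belongs to exactly two chambers. -/
def IsPseudomanifold (X : SComplex V) (n : ℕ) : Prop :=
  IsChamberComplex X n ∧
    ∀ σ ∈ X.faces, σ.card = n →
      ({τ | τ ∈ X.faces ∧ σ ⊆ τ ∧ τ.card = n + 1} : Set (Finset V)).ncard = 2

/-- The dimension of a (finite-dimensional) simplicial complex. -/
noncomputable def dim (X : SComplex V) : ℕ := sSup {n : ℕ | ∃ σ ∈ X.faces, σ.card = n + 1}

/-- A simplicial complex is finite dimensional. -/
def IsFiniteDimensional (X : SComplex V) : Prop :=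
  ∃ N : ℕ, ∀ σ ∈ X.faces, σ.card ≤ N + 1

end SComplex
/-- The condition `Conn_n^∞(Y)`: for every compact `K ⊆ Y` there is a compact
`L ⊇ K` such that every map of the `n`-sphere into `Y ∖ L` extends to a map of the
`(n+1)`-ball into `Y ∖ K`. -/
def ConnInfty (Y : Type u) [TopologicalSpace Y] (n : ℤ) : Prop :=
  ∀ K : Set Y, IsCompact K → ∃ L : Set Y, IsCompact L ∧ K ⊆ L ∧
    ∀ f : EuclideanSpace ℝ (Fin (n + 1).toNat) → Y,
      ContinuousOn f (Metric.sphere 0 1) →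
      (∀ x ∈ Metric.sphere (0 : EuclideanSpace ℝ (Fin (n + 1).toNat)) 1, f x ∉ L) →
      ∃ g : EuclideanSpace ℝ (Fin (n + 1).toNat) → Y,
        ContinuousOn g (Metric.closedBall 0 1) ∧
        (∀ x ∈ Metric.closedBall (0 : EuclideanSpace ℝ (Fin (n + 1).toNat)) 1, g x ∉ K) ∧
        ∀ x ∈ Metric.sphere (0 : EuclideanSpace ℝ (Fin (n + 1).toNat)) 1, g x = f x

/-- A space is `n`-connected at infinity if `Conn_k^∞` holds for all `-1 ≤ k ≤ n`. -/
def ConnectedAtInftyUpTo (Y : Type u) [TopologicalSpace Y] (n : ℤ) : Prop :=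
  ∀ k : ℤ, -1 ≤ k → k ≤ n → ConnInfty Y k

/-- A CW structure on a topological space `X`: cells in each dimension with
characteristic maps defined on closed unit balls, such that the open cells partition
`X`, attaching spheres land in lower-dimensional cells, each closed cell meets only
finitely many open cells, and `X` carries the weak topology. -/
structure CWStructure (X : Type u) [TopologicalSpace X] where
  cell : ℕ → Type
  attach : (n : ℕ) → cell n → (EuclideanSpace ℝ (Fin n) → X)
  continuousOn_attach : ∀ n i, ContinuousOn (attach n i) (Metric.closedBall 0 1)
  injOn_attach : ∀ n i, Set.InjOn (attach n i) (Metric.ball 0 1)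
  pairwiseDisjoint :
    Set.univ.PairwiseDisjoint
      (fun p : Σ n, cell n => attach p.1 p.2 '' Metric.ball 0 1)
  cover : (⋃ p : Σ n, cell n, attach p.1 p.2 '' Metric.ball 0 1) = Set.univ
  attach_sphere : ∀ n i, attach n i '' Metric.sphere 0 1 ⊆
    ⋃ (p : Σ m, cell m) (_ : p.1 < n), attach p.1 p.2 '' Metric.ball 0 1
  closure_finiteness : ∀ n i,
    {p : Σ m, cell m | (attach p.1 p.2 '' Metric.ball 0 1) ∩
      (attach n i '' Metric.closedBall 0 1) ≠ ∅}.Finite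
  weak_topology : ∀ A : Set X,
    (∀ n i, IsClosed {x : EuclideanSpace ℝ (Fin n) |
      x ∈ Metric.closedBall 0 1 ∧ attach n i x ∈ A}) → IsClosed A

/-- The open cell of a CW structure. -/
def CWStructure.openCell {X : Type u} [TopologicalSpace X] (cw : CWStructure X)
    (n : ℕ) (i : cw.cell n) : Set X :=
  cw.attach n i '' Metric.ball 0 1

/-- A rigid cellular action of a group on a CW complex: the action is by
homeomorphisms permuting the open cells, and any element stabilizing a cell fixes it
pointwise. -/
def IsRigidCellularAction (G : Type) [Group G] {X : Type u} [TopologicalSpace X]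
    [MulAction G X] (cw : CWStructure X) : Prop :=
  (∀ g : G, Continuous fun x : X => g • x) ∧
  (∀ (g : G) (n : ℕ) (i : cw.cell n), ∃ j : cw.cell n,
    (fun x => g • x) '' cw.openCell n i = cw.openCell n j) ∧
  (∀ (g : G) (n : ℕ) (i : cw.cell n),
    (fun x => g • x) '' cw.openCell n i = cw.openCell n i →
      ∀ x ∈ cw.openCell n i, g • x = x)

/-- A group action on a topological space is cocompact. -/
def IsCocompactAction (G : Type) (X : Type u) [Group G] [TopologicalSpace X]
    [MulAction G X] : Prop :=
  ∃ K : Set X, IsCompact K ∧ (⋃ g : G, (fun x => g • x) '' K) = Set.univ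

/-- The condition `Conn_n^∞(G)` for a group `G`: `Conn_n^∞(X)` holds for every
contractible rigid `G`-CW complex `X` on which `G` acts properly discontinuously and
cocompactly. -/
def ConnInftyGroup (G : Type) [Group G] (n : ℤ) : Prop :=
  ∀ (X : Type) [TopologicalSpace X] [MulAction G X],
    ContractibleSpace X →
    (∃ cw : CWStructure X, IsRigidCellularAction G cw) →
    ProperlyDiscontinuousSMul G X →
    IsCocompactAction G X →
    ConnInfty X n

namespace SComplex

variable {V : Type u} [DecidableEq V]

/-- A group action on the vertices is simplicial if it maps faces to faces. -/
def IsSimplicialAction (G : Type) [Group G] [MulAction G V] (X : SComplex V) : Prop :=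
  ∀ (g : G), ∀ σ ∈ X.faces, σ.image (fun v => g • v) ∈ X.faces

/-- A simplicial action is properly discontinuous: all simplex stabilizers are finite. -/
def HasFiniteStabilizers (G : Type) [Group G] [MulAction G V] (X : SComplex V) : Prop :=
  ∀ σ ∈ X.faces, {g : G | σ.image (fun v => g • v) = σ}.Finite

/-- A simplicial action is cocompact: there are finitely many orbits of simplices. -/
def IsCocompactSAction (G : Type) [Group G] [MulAction G V] (X : SComplex V) : Prop :=
  ∃ S : Set (Finset V), S.Finite ∧
    ∀ τ ∈ X.faces, ∃ σ ∈ S, ∃ g : G, τ = σ.image (fun v => g • v)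

end SComplex

/-- A systolic group: a group admitting a properly discontinuous cocompact action by
simplicial automorphisms on a systolic complex. -/
def IsSystolicGroup (G : Type) [Group G] : Prop :=
  ∃ (V : Type) (_ : DecidableEq V) (X : SComplex V) (_ : MulAction G V),
    X.Systolic ∧ X.IsSimplicialAction G ∧ X.HasFiniteStabilizers G ∧
      X.IsCocompactSAction G

namespace SComplex

section Links

variable {V : Type u} [DecidableEq V]

/-- Distinct vertices `a`, `b` joined by an edge. -/
def Edge (Y : SComplex V) (a b : V) : Prop := a ≠ b ∧ ({a, b} : Finset V) ∈ Y.faces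

/-- Pairwise distinct vertices `a`, `b`, `c` spanning a triangle. -/
def Tri (Y : SComplex V) (a b c : V) : Prop :=
  a ≠ b ∧ a ≠ c ∧ b ≠ c ∧ ({a, b, c} : Finset V) ∈ Y.faces

/-- Local `6`-largeness, spelled out for the links of vertices. -/
structure SixLargeLinks (Y : SComplex V) : Prop where
  flag : ∀ (v : V) (τ : Finset V), τ.Nonempty → v ∉ τ → (∀ a ∈ τ, Y.Edge v a) →
    (∀ a ∈ τ, ∀ b ∈ τ, a ≠ b → Y.Tri v a b) → insert v τ ∈ Y.faces
  four : ∀ {v a b c d : V}, Y.Tri v a b → Y.Tri v b c → Y.Tri v c d → Y.Tri v d a →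
    a ≠ c → b ≠ d → Y.Tri v a c ∨ Y.Tri v b d
  five : ∀ {v a b c d e : V}, Y.Tri v a b → Y.Tri v b c → Y.Tri v c d → Y.Tri v d e →
    Y.Tri v e a → a ≠ c → b ≠ d → c ≠ e → d ≠ a → e ≠ b →
    Y.Tri v a c ∨ Y.Tri v b d ∨ Y.Tri v c e ∨ Y.Tri v d a ∨ Y.Tri v e b

variable {Y : SComplex V} {a b c u : V}

theorem Edge.symm (h : Y.Edge a b) : Y.Edge b a :=
  ⟨h.1.symm, by rw [Finset.pair_comm]; exact h.2⟩

theorem Tri.swap (h : Y.Tri a b c) : Y.Tri a c b :=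
  ⟨h.2.1, h.1, h.2.2.1.symm, by rw [Finset.pair_comm]; exact h.2.2.2⟩

theorem Tri.swap_left (h : Y.Tri a b c) : Y.Tri b a c :=
  ⟨h.1.symm, h.2.2.1, h.2.1, by rw [Finset.insert_comm]; exact h.2.2.2⟩

theorem Tri.rotate (h : Y.Tri a b c) : Y.Tri b c a := h.swap_left.swap

theorem Tri.edge (h : Y.Tri a b c) : Y.Edge a b :=
  ⟨h.1, Y.down_closed _ h.2.2.2 _ (by intro x; simp; tauto) (by simp)⟩

theorem Edge.left_mem (h : Y.Edge a b) : {a} ∈ Y.faces :=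
  Y.down_closed _ h.2 _ (by simp) (by simp)

theorem SixLargeLinks.tetra (h : Y.SixLargeLinks) (h₁ : Y.Tri u a b) (h₂ : Y.Tri u a c)
    (h₃ : Y.Tri u b c) : Y.Tri a b c := by
  refine ⟨h₁.2.2.1, h₂.2.2.1, h₃.2.2.1, Y.down_closed _ (h.flag u {a, b, c} ?_ ?_ ?_ ?_) _
    (Finset.subset_insert _ _) (by simp)⟩
  · simp
  · simp [h₁.1, h₁.2.1, h₂.2.1]
  · simp [h₁.edge, h₁.swap.edge, h₂.swap.edge]
  · have := h₁.swap
    have := h₂.swap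
    have := h₃.swap
    simp only [Finset.mem_insert, Finset.mem_singleton]
    rintro x (rfl | rfl | rfl) y (rfl | rfl | rfl) hxy <;> first | assumption | exact absurd rfl hxy

theorem SixLargeLinks.restrict (h : Y.SixLargeLinks) (W : Set V) :
    (Y.restrict W).SixLargeLinks := by
  have key : ∀ {v a b : V}, (Y.restrict W).Tri v a b ↔
      Y.Tri v a b ∧ v ∈ W ∧ a ∈ W ∧ b ∈ W := by
    intro v a b
    simp only [Tri, SComplex.restrict, Set.mem_ofPred_eq, Finset.mem_insert, Finset.mem_singleton,
      forall_eq_or_imp, forall_eq]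
    tauto
  have keyE : ∀ {v a : V}, (Y.restrict W).Edge v a ↔ Y.Edge v a ∧ v ∈ W ∧ a ∈ W := by
    intro v a
    simp only [Edge, SComplex.restrict, Set.mem_ofPred_eq, Finset.mem_insert, Finset.mem_singleton,
      forall_eq_or_imp, forall_eq]
    tauto
  refine ⟨fun v τ hne hv hE hT => ⟨h.flag v τ hne hv (fun a ha => (keyE.1 (hE a ha)).1)
    (fun a ha b hb hab => (key.1 (hT a ha b hb hab)).1), ?_⟩, ?_, ?_⟩
  · obtain ⟨x, hx⟩ := hne
    intro y hy
    rcases Finset.mem_insert.1 hy with rfl | hy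
    · exact (keyE.1 (hE x hx)).2.1
    · exact (keyE.1 (hE y hy)).2.2
  · intro v a b c d
    simp only [key]
    rintro ⟨h₁, hW₁⟩ ⟨h₂, hW₂⟩ ⟨h₃, hW₃⟩ ⟨h₄, hW₄⟩ hac hbd
    have := h.four h₁ h₂ h₃ h₄ hac hbd
    tauto
  · intro v a b c d e
    simp only [key]
    rintro ⟨h₁, hW₁⟩ ⟨h₂, hW₂⟩ ⟨h₃, hW₃⟩ ⟨h₄, hW₄⟩ ⟨h₅, hW₅⟩ hac hbd hce hda heb
    have := h.five h₁ h₂ h₃ h₄ h₅ hac hbd hce hda heb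
    tauto

theorem mem_link_pair {v a b : V} (hab : a ≠ b) :
    {a, b} ∈ (Y.link {v}).faces ↔ Y.Tri v a b := by
  have h : ({a, b} ∪ {v} : Finset V) = {v, a, b} := by ext; simp; tauto
  simp only [link, Set.mem_ofPred_eq, Finset.disjoint_singleton_right, Finset.mem_insert,
    Finset.mem_singleton, h, Tri]
  constructor
  · tauto
  · rintro ⟨h₁, h₂, -, h₃⟩
    exact ⟨Y.down_closed _ h₃ _ (Finset.subset_insert _ _) (by simp), by tauto, h₃⟩

theorem mem_link_singleton {v a : V} : {a} ∈ (Y.link {v}).faces ↔ Y.Edge v a := by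
  have h : ({a} ∪ {v} : Finset V) = {v, a} := by ext; simp; tauto
  simp only [link, Set.mem_ofPred_eq, Finset.disjoint_singleton_right,
    Finset.mem_singleton, h, Edge]
  constructor
  · tauto
  · rintro ⟨h₁, h₂⟩
    exact ⟨Y.down_closed _ h₂ _ (by simp) (by simp), by tauto, h₂⟩

theorem LocallyKLarge.sixLargeLinks (h : Y.LocallyKLarge 6) : Y.SixLargeLinks := by
  refine ⟨fun v τ hne hv hE hT => ?_, ?_, ?_⟩
  · obtain ⟨x, hx⟩ := hne
    have := ((h {v} (hE x hx).left_mem).1 τ ⟨x, hx⟩ (fun a ha => mem_link_singleton.2 (hE a ha))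
      (fun a ha b hb hab => (mem_link_pair hab).2 (hT a ha b hb hab))).2.2
    rwa [Finset.union_comm] at this
  · intro v a b c d h₁ h₂ h₃ h₄ hac hbd
    have hl := (h {v} h₁.edge.left_mem).2 4 ![a, b, c, d] ?_ le_rfl (by norm_num)
    · obtain ⟨i, j, hij, hij₁, hij₂, hm⟩ := hl
      have e₁ := @mem_link_pair V _ Y v a c hac
      have e₂ := @mem_link_pair V _ Y v b d hbd
      have e₃ := @mem_link_pair V _ Y v c a hac.symm
      have e₄ := @mem_link_pair V _ Y v d b hbd.symm
      change Fin 4 at i j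
      fin_cases i <;> fin_cases j <;> first
        | exact absurd rfl hij | exact absurd rfl hij₁ | exact absurd rfl hij₂
        | exact Or.inl (e₁.1 hm) | exact Or.inl (e₃.1 hm).swap
        | exact Or.inr (e₂.1 hm) | exact Or.inr (e₄.1 hm).swap
    · refine ⟨by norm_num, ?_, ?_⟩
      · intro i j hij
        have := h₁.2.2.1
        have := h₂.2.2.1
        have := h₃.2.2.1
        have := h₄.2.2.1
        change Fin 4 at i j
        fin_cases i <;> fin_cases j <;> first | rfl | simp_all
      · intro i
        change Fin 4 at i
        fin_cases i
        · exact (mem_link_pair h₁.2.2.1).2 h₁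
        · exact (mem_link_pair h₂.2.2.1).2 h₂
        · exact (mem_link_pair h₃.2.2.1).2 h₃
        · exact (mem_link_pair h₄.2.2.1).2 h₄
  · intro v a b c d e h₁ h₂ h₃ h₄ h₅ hac hbd hce hda heb
    have hl := (h {v} h₁.edge.left_mem).2 5 ![a, b, c, d, e] ?_ (by norm_num) (by norm_num)
    · obtain ⟨i, j, hij, hij₁, hij₂, hm⟩ := hl
      have hm' : {![a, b, c, d, e] j, ![a, b, c, d, e] i} ∈ (Y.link {v}).faces := by
        rw [Finset.pair_comm]; exact hm
      have e₁ := @mem_link_pair V _ Y v a c hac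
      have e₂ := @mem_link_pair V _ Y v b d hbd
      have e₃ := @mem_link_pair V _ Y v c e hce
      have e₄ := @mem_link_pair V _ Y v d a hda
      have e₅ := @mem_link_pair V _ Y v e b heb
      rw [← e₁, ← e₂, ← e₃, ← e₄, ← e₅]
      change Fin 5 at i j
      fin_cases i <;> fin_cases j <;> first
        | exact absurd rfl hij | exact absurd rfl hij₁ | exact absurd rfl hij₂
        | exact Or.inl hm | exact Or.inl hm'
        | exact Or.inr (Or.inl hm) | exact Or.inr (Or.inl hm')
        | exact Or.inr (Or.inr (Or.inl hm)) | exact Or.inr (Or.inr (Or.inl hm'))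
        | exact Or.inr (Or.inr (Or.inr (Or.inl hm))) | exact Or.inr (Or.inr (Or.inr (Or.inl hm')))
        | exact Or.inr (Or.inr (Or.inr (Or.inr hm))) | exact Or.inr (Or.inr (Or.inr (Or.inr hm')))
    · refine ⟨by norm_num, ?_, ?_⟩
      · intro i j hij
        have := h₁.2.2.1
        have := h₂.2.2.1
        have := h₃.2.2.1
        have := h₄.2.2.1
        have := h₅.2.2.1
        change Fin 5 at i j
        fin_cases i <;> fin_cases j <;> first | rfl | simp_all
      · intro i
        change Fin 5 at i
        fin_cases i
        · exact (mem_link_pair h₁.2.2.1).2 h₁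
        · exact (mem_link_pair h₂.2.2.1).2 h₂
        · exact (mem_link_pair h₃.2.2.1).2 h₃
        · exact (mem_link_pair h₄.2.2.1).2 h₄
        · exact (mem_link_pair h₅.2.2.1).2 h₅

end Links

section ListOrder

variable {V : Type u}

/-- Compare lists by length, then lexicographically starting from the last entry. -/
def RevShortlex : List V → List V → Prop :=
  InvImage (List.Shortlex WellOrderingRel) List.reverse

theorem wellFounded_revShortlex : WellFounded (RevShortlex (V := V)) :=
  InvImage.wf _ (List.Shortlex.wf WellOrderingRel.isWellOrder.wf)

instance : Std.Trichotomous (RevShortlex (V := V)) :=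
  InvImage.trichotomous List.reverse_injective

instance : IsWellOrder (List V) RevShortlex where
  wf := wellFounded_revShortlex

theorem RevShortlex.of_length_lt {a b : List V} (h : a.length < b.length) : RevShortlex a b :=
  List.Shortlex.of_length_lt (by simpa using h)

theorem RevShortlex.length_le {a b : List V} (h : RevShortlex a b) : a.length ≤ b.length := by
  rcases List.shortlex_def.1 h with h | h <;> simp at h <;> omega

theorem lex_append_of_length_eq {r : V → V → Prop} : ∀ {a b : List V} (s t : List V),
    a.length = b.length → List.Lex r a b → List.Lex r (a ++ s) (b ++ t)
  | _, _, _, _, h, .nil => by simp at h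
  | _, _, _, _, _, .rel h => .rel h
  | _, _, _, _, h, .cons h' => .cons (lex_append_of_length_eq _ _ (by simpa using h) h')

theorem RevShortlex.tail {a b : List V} {x y : V} (h : RevShortlex (x :: a) (y :: b))
    (hl : a.length = b.length) : RevShortlex a b ∨ a = b := by
  rcases trichotomous_of RevShortlex a b with h' | h' | h'
  · exact .inl h'
  · exact .inr h'
  · refine absurd h (asymm_of RevShortlex ?_)
    refine List.Shortlex.of_lex (by simp [hl]) ?_
    rw [List.reverse_cons, List.reverse_cons]
    exact lex_append_of_length_eq _ _ (by simp [hl])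
      ((List.shortlex_iff_lex (by simp [hl])).1 h')

open Classical in
/-- The least element of a nonempty set of lists (and `[]` for the empty set). -/
noncomputable def leastList (S : Set (List V)) : List V :=
  if h : S.Nonempty then wellFounded_revShortlex.min S h else []

end ListOrder

section Development

variable {V : Type u} [DecidableEq V]

/-- The head of a list, `v₀` for the empty list: the projection of the development. -/
abbrev dproj (v₀ : V) (l : List V) : V := l.headD v₀

/-- A partial development: a set of vertices, encoded as lists in `V`, and an adjacency relation. -/
structure Dev (V : Type u) where
  verts : Set (List V)
  adj : List V → List V → Prop

variable (Y : SComplex V) (v₀ : V) (n : ℕ) (D : Dev V)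

/-- The vertex `w` of the link of the image of `v` is still missing from the star of `v`. -/
def Cand (v : List V) (w : V) : Prop :=
  v ∈ D.verts ∧ v.length = n ∧ Y.Edge (dproj v₀ v) w ∧ ∀ a, D.adj v a → dproj v₀ a ≠ w

/-- The candidates over `w` which have to be identified with the candidate given by `v`. -/
def candClass (v : List V) (w : V) : Set (List V) :=
  {u | Y.Cand v₀ n D u w ∧ (u = v ∨ (D.adj u v ∧ Y.Tri (dproj v₀ u) (dproj v₀ v) w))}

/-- The new vertex over `w` adjacent to `v`, encoded through the least element of the class. -/
noncomputable def newVert (v : List V) (w : V) : List V :=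
  w :: leastList (Y.candClass v₀ n D v w)

/-- Adjacency in the enlarged development. -/
inductive NextAdj : List V → List V → Prop
  | old {a b} : D.adj a b → NextAdj a b
  | up {v w} : Y.Cand v₀ n D v w → NextAdj v (Y.newVert v₀ n D v w)
  | down {v w} : Y.Cand v₀ n D v w → NextAdj (Y.newVert v₀ n D v w) v
  | side {v w w₁} : Y.Cand v₀ n D v w → Y.Cand v₀ n D v w₁ → Y.Tri (dproj v₀ v) w w₁ →
      NextAdj (Y.newVert v₀ n D v w) (Y.newVert v₀ n D v w₁)

/-- The development with one more layer. -/
def nextDev : Dev V where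
  verts := D.verts ∪ {x | ∃ v w, Y.Cand v₀ n D v w ∧ x = Y.newVert v₀ n D v w}
  adj := Y.NextAdj v₀ n D

/-- The development of radius `n`. -/
def stage : ℕ → Dev V
  | 0 => ⟨{[]}, fun _ _ => False⟩
  | n + 1 => Y.nextDev v₀ n (stage n)

/-- The invariants of the development of radius `n`. -/
structure DevInv : Prop where
  length_le : ∀ {a}, a ∈ D.verts → a.length ≤ n
  symm : ∀ {a b}, D.adj a b → D.adj b a
  left_mem : ∀ {a b}, D.adj a b → a ∈ D.verts
  edge : ∀ {a b}, D.adj a b → Y.Edge (dproj v₀ a) (dproj v₀ b)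
  level : ∀ {a b}, D.adj a b → b.length ≤ a.length + 1
  tri : ∀ {v a b}, D.adj v a → D.adj v b → D.adj a b →
    Y.Tri (dproj v₀ v) (dproj v₀ a) (dproj v₀ b)
  inj : ∀ {v a b}, D.adj v a → D.adj v b → dproj v₀ a = dproj v₀ b → a = b
  full : ∀ {v a b}, D.adj v a → D.adj v b →
    Y.Tri (dproj v₀ v) (dproj v₀ a) (dproj v₀ b) → D.adj a b
  lift : ∀ {v w}, v ∈ D.verts → v.length < n → Y.Edge (dproj v₀ v) w →
    ∃ a, D.adj v a ∧ dproj v₀ a = w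
  father : ∀ {w v}, w :: v ∈ D.verts → D.adj (w :: v) v
  father_le : ∀ {w v u}, D.adj (w :: v) u → u.length = v.length → ¬ RevShortlex u v
  clique : ∀ {w a b}, D.adj w a → D.adj w b → a.length + 1 = w.length →
    b.length + 1 = w.length → a ≠ b → D.adj a b
  common : ∀ {a b}, D.adj a b → a.length = b.length →
    ∃ u, D.adj u a ∧ D.adj u b ∧ u.length + 1 = a.length

variable {Y v₀ n D} {a b u v x y z : List V} {w w' : V}

namespace DevInv

variable (h : Y.DevInv v₀ n D) (hY : Y.SixLargeLinks)
include h

theorem right_mem (hab : D.adj a b) : b ∈ D.verts := h.left_mem (h.symm hab)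

theorem irrefl (hab : D.adj a b) : a ≠ b := by
  rintro rfl
  exact (h.edge hab).1 rfl

omit h in
theorem mem_candClass (hc : Y.Cand v₀ n D v w) : v ∈ Y.candClass v₀ n D v w := ⟨hc, .inl rfl⟩

theorem candClass_symm (hc : Y.Cand v₀ n D v w) (hu : u ∈ Y.candClass v₀ n D v w) :
    v ∈ Y.candClass v₀ n D u w := by
  obtain ⟨hu, rfl | ⟨ha, ht⟩⟩ := hu
  · exact ⟨hc, .inl rfl⟩
  · exact ⟨hc, .inr ⟨h.symm ha, ht.swap_left⟩⟩

theorem cand_of_adj (hc : Y.Cand v₀ n D v w) (hu : D.adj u v) (hl : u.length = n)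
    (ht : Y.Tri (dproj v₀ u) (dproj v₀ v) w) : Y.Cand v₀ n D u w := by
  refine ⟨h.left_mem hu, hl, ht.swap.edge, ?_⟩
  rintro a ha rfl
  exact hc.2.2.2 a (h.full hu ha ht) rfl

theorem not_tri_of_length_lt (hc : Y.Cand v₀ n D v w) (hu : D.adj u v) (hl : u.length < n) :
    ¬ Y.Tri (dproj v₀ v) (dproj v₀ u) w := by
  intro ht
  obtain ⟨c, hc', rfl⟩ := h.lift (h.left_mem hu) hl ht.rotate.edge
  exact hc.2.2.2 c (h.full hu hc' ht.swap_left) rfl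

include hY

theorem candClass_trans (hu : u ∈ Y.candClass v₀ n D v w) (ha : a ∈ Y.candClass v₀ n D u w) :
    a ∈ Y.candClass v₀ n D v w := by
  obtain ⟨hcu, rfl | ⟨huv, htuv⟩⟩ := hu
  · exact ha
  obtain ⟨hca, rfl | ⟨hau, htau⟩⟩ := ha
  · exact ⟨hca, .inr ⟨huv, htuv⟩⟩
  refine ⟨hca, ?_⟩
  by_cases hav : a = v
  · exact .inl hav
  have hcv : Y.Cand v₀ n D v w := by
    have hm := h.right_mem huv
    have hl := h.level (h.symm huv)
    have hl' := h.length_le hm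
    have := hcu.2.1
    have hlv : v.length = n := by
      by_contra hne
      exact h.not_tri_of_length_lt hcu (h.symm huv) (by omega) htuv
    exact h.cand_of_adj hcu (h.symm huv) hlv htuv.swap_left
  suffices ht : Y.Tri (dproj v₀ u) (dproj v₀ a) (dproj v₀ v) from
    .inr ⟨h.full (h.symm hau) huv ht, hY.tetra ht htau.swap_left htuv⟩
  have hne : dproj v₀ a ≠ dproj v₀ v := fun he => hav (h.inj (h.symm hau) huv he)
  obtain ⟨s, hsa, hsu, hsl⟩ := h.common hau (by rw [hca.2.1, hcu.2.1])
  obtain ⟨t, htu, htv, htl⟩ := h.common huv (by rw [hcv.2.1, hcu.2.1])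
  have hln := hcu.2.1
  have hln' := hca.2.1
  have hws := h.not_tri_of_length_lt hcu hsu (by omega)
  have hwt := h.not_tri_of_length_lt hcu htu (by omega)
  have hsa' : Y.Tri (dproj v₀ u) (dproj v₀ s) (dproj v₀ a) :=
    h.tri (h.symm hsu) (h.symm hau) hsa
  have htv' : Y.Tri (dproj v₀ u) (dproj v₀ v) (dproj v₀ t) :=
    h.tri huv (h.symm htu) (h.symm htv)
  have hwa := htau.swap_left
  have hwv := htuv.swap
  have hs : w ≠ dproj v₀ s := (hcu.2.2.2 s (h.symm hsu)).symm
  have ht : w ≠ dproj v₀ t := (hcu.2.2.2 t (h.symm htu)).symm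
  have hat : dproj v₀ a ≠ dproj v₀ t := by
    intro he
    have := h.inj (h.symm hau) (h.symm htu) he
    subst this
    omega
  have hvs : dproj v₀ v ≠ dproj v₀ s := by
    intro he
    have := h.inj huv (h.symm hsu) he
    subst this
    have := hcv.2.1
    omega
  have four : ∀ {p : V}, p ≠ w → Y.Tri (dproj v₀ u) (dproj v₀ v) p →
      Y.Tri (dproj v₀ u) p (dproj v₀ a) → ¬ Y.Tri (dproj v₀ u) p w →
      Y.Tri (dproj v₀ u) (dproj v₀ a) (dproj v₀ v) := by
    intro p hp h₁ h₂ h₃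
    rcases hY.four hwa hwv h₁ h₂ hne hp.symm with h' | h'
    · exact h'
    · exact absurd h'.swap h₃
  by_cases hst : s = t
  · subst hst
    exact four hs.symm htv' hsa' hws
  have hst' := h.tri (h.symm htu) (h.symm hsu) (h.clique (h.symm htu) (h.symm hsu) htl
    (by omega) (Ne.symm hst))
  rcases hY.five hwa hwv htv' hst' hsa' hne ht hvs hat.symm hs.symm with h' | h' | h' | h' | h'
  · exact h'
  · exact absurd h'.swap hwt
  · exact four hs.symm h' hsa' hws
  · exact four ht.symm htv' h' hwt
  · exact absurd h' hws

theorem newVert_congr (hc : Y.Cand v₀ n D v w) (hu : u ∈ Y.candClass v₀ n D v w) :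
    Y.newVert v₀ n D u w = Y.newVert v₀ n D v w := by
  have : Y.candClass v₀ n D u w = Y.candClass v₀ n D v w := by
    ext a
    exact ⟨fun ha => h.candClass_trans hY hu ha,
      fun ha => h.candClass_trans hY (h.candClass_symm hc hu) ha⟩
  rw [newVert, newVert, this]

omit h hY in
theorem exists_newVert_eq (hc : Y.Cand v₀ n D v w) :
    ∃ m ∈ Y.candClass v₀ n D v w, Y.newVert v₀ n D v w = w :: m ∧
      ∀ u ∈ Y.candClass v₀ n D v w, ¬ RevShortlex u m := by
  have hne : (Y.candClass v₀ n D v w).Nonempty := ⟨v, mem_candClass hc⟩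
  refine ⟨wellFounded_revShortlex.min _ hne, WellFounded.min_mem _ _ _, ?_, fun u hu =>
    WellFounded.not_lt_min _ _ hu⟩
  rw [newVert, leastList, dif_pos hne]

omit h hY in
theorem length_newVert (hc : Y.Cand v₀ n D v w) : (Y.newVert v₀ n D v w).length = n + 1 := by
  obtain ⟨m, hm, he, -⟩ := exists_newVert_eq hc
  rw [he, List.length_cons, hm.1.2.1]

omit h hY in
theorem dproj_newVert : dproj v₀ (Y.newVert v₀ n D v w) = w := rfl

theorem newVert_inj (hc : Y.Cand v₀ n D v w) (hc' : Y.Cand v₀ n D u w')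
    (he : Y.newVert v₀ n D u w' = Y.newVert v₀ n D v w) :
    w' = w ∧ u ∈ Y.candClass v₀ n D v w := by
  obtain ⟨m, hm, hme, -⟩ := exists_newVert_eq hc
  obtain ⟨m', hm', hme', -⟩ := exists_newVert_eq hc'
  rw [hme, hme'] at he
  obtain ⟨rfl, rfl⟩ := List.cons.inj he
  exact ⟨rfl, h.candClass_trans hY hm (h.candClass_symm hc' hm')⟩

end DevInv

end Development

section Stages

variable {V : Type u} [DecidableEq V]

variable {Y : SComplex V} {v₀ : V} {n : ℕ} {D : Dev V}
  {a b c u v x y z : List V} {w w' : V}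

namespace DevInv

theorem newVert_notMem (h : Y.DevInv v₀ n D) (hc : Y.Cand v₀ n D v w) :
    Y.newVert v₀ n D v w ∉ D.verts := by
  intro hm
  have := h.length_le hm
  rw [length_newVert hc] at this
  omega

variable (h : Y.DevInv v₀ n D) (hY : Y.SixLargeLinks)
include h

theorem nextAdj_symm (hab : Y.NextAdj v₀ n D a b) : Y.NextAdj v₀ n D b a := by
  cases hab with
  | old h' => exact .old (h.symm h')
  | up hc => exact .down hc
  | down hc => exact .up hc
  | side hc hc' ht => exact .side hc' hc ht.swap

theorem nextAdj_level (hab : Y.NextAdj v₀ n D a b) : b.length ≤ a.length + 1 := by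
  cases hab with
  | old h' => exact h.level h'
  | up hc => rw [length_newVert hc, hc.2.1]
  | down hc => rw [length_newVert hc, hc.2.1]; omega
  | side hc hc' ht => rw [length_newVert hc, length_newVert hc']; omega

theorem nextAdj_edge (hab : Y.NextAdj v₀ n D a b) : Y.Edge (dproj v₀ a) (dproj v₀ b) := by
  cases hab with
  | old h' => exact h.edge h'
  | up hc => exact hc.2.2.1
  | down hc => exact hc.2.2.1.symm
  | side hc hc' ht => exact ht.rotate.edge

theorem nextAdj_old (ha : a ∈ D.verts) (hb : b ∈ D.verts) (hab : Y.NextAdj v₀ n D a b) :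
    D.adj a b := by
  cases hab with
  | old h' => exact h'
  | up hc => exact absurd hb (h.newVert_notMem hc)
  | down hc => exact absurd ha (h.newVert_notMem hc)
  | side hc hc' ht => exact absurd ha (h.newVert_notMem hc)

theorem nextAdj_star (ha : a ∈ D.verts) (hab : Y.NextAdj v₀ n D a b) :
    D.adj a b ∨ ∃ w, Y.Cand v₀ n D a w ∧ b = Y.newVert v₀ n D a w := by
  cases hab with
  | old h' => exact .inl h'
  | up hc => exact .inr ⟨_, hc, rfl⟩
  | down hc => exact absurd ha (h.newVert_notMem hc)
  | side hc hc' ht => exact absurd ha (h.newVert_notMem hc)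

include hY

theorem nextAdj_newVert_of_mem (hc : Y.Cand v₀ n D v w) (ha : a ∈ D.verts)
    (hab : Y.NextAdj v₀ n D (Y.newVert v₀ n D v w) a) : a ∈ Y.candClass v₀ n D v w := by
  rcases h.nextAdj_star ha (h.nextAdj_symm hab) with h' | ⟨w', hc', he⟩
  · exact absurd (h.right_mem h') (h.newVert_notMem hc)
  · exact (h.newVert_inj hY hc hc' he.symm).2

theorem nextAdj_newVert_newVert (hc : Y.Cand v₀ n D v w) (hc' : Y.Cand v₀ n D u w')
    (hab : Y.NextAdj v₀ n D (Y.newVert v₀ n D v w) (Y.newVert v₀ n D u w')) :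
    ∃ m, m ∈ Y.candClass v₀ n D v w ∧ m ∈ Y.candClass v₀ n D u w' ∧ Y.Tri (dproj v₀ m) w w' := by
  generalize hx : Y.newVert v₀ n D v w = x at hab
  generalize hy : Y.newVert v₀ n D u w' = y at hab
  cases hab with
  | old h' =>
    subst hx
    exact absurd (h.left_mem h') (h.newVert_notMem hc)
  | up hc'' =>
    subst hx
    exact absurd hc''.1 (h.newVert_notMem hc)
  | down hc'' =>
    subst hy
    exact absurd hc''.1 (h.newVert_notMem hc')
  | @side m _ _ hm hm' ht =>
    obtain ⟨rfl, h₁⟩ := h.newVert_inj hY hc hm hx.symm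
    obtain ⟨rfl, h₂⟩ := h.newVert_inj hY hc' hm' hy.symm
    exact ⟨m, h₁, h₂, ht⟩

theorem star_tri (hv : v ∈ D.verts) (ha : Y.NextAdj v₀ n D v a) (hb : Y.NextAdj v₀ n D v b)
    (hab : Y.NextAdj v₀ n D a b) : Y.Tri (dproj v₀ v) (dproj v₀ a) (dproj v₀ b) := by
  have mixed : ∀ {a b : List V}, D.adj v a → Y.NextAdj v₀ n D a b →
      (∃ w, Y.Cand v₀ n D v w ∧ b = Y.newVert v₀ n D v w) →
      Y.Tri (dproj v₀ v) (dproj v₀ a) (dproj v₀ b) := by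
    rintro a b ha hab ⟨w, hc, rfl⟩
    rcases (h.nextAdj_newVert_of_mem hY hc (h.right_mem ha) (h.nextAdj_symm hab)).2 with rfl | h'
    · exact absurd rfl (h.irrefl ha)
    · exact h'.2.swap_left
  rcases h.nextAdj_star hv ha with ha' | ⟨w, hc, rfl⟩
  · rcases h.nextAdj_star hv hb with hb' | hb'
    · exact h.tri ha' hb' (h.nextAdj_old (h.right_mem ha') (h.right_mem hb') hab)
    · exact mixed ha' hab hb'
  · rcases h.nextAdj_star hv hb with hb' | ⟨w', hc', rfl⟩
    · exact (mixed hb' (h.nextAdj_symm hab) ⟨w, hc, rfl⟩).swap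
    · obtain ⟨m, ⟨hm₁, hm₂⟩, ⟨hm₃, hm₄⟩, ht⟩ := h.nextAdj_newVert_newVert hY hc hc' hab
      rcases hm₂ with rfl | ⟨-, hm₂⟩
      · exact ht
      rcases hm₄ with rfl | ⟨-, hm₄⟩
      · exact ht
      exact hY.tetra hm₂ hm₄ ht

omit hY in
theorem star_inj (hv : v ∈ D.verts) (ha : Y.NextAdj v₀ n D v a) (hb : Y.NextAdj v₀ n D v b)
    (hab : dproj v₀ a = dproj v₀ b) : a = b := by
  rcases h.nextAdj_star hv ha with ha' | ⟨w, hc, rfl⟩ <;>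
    rcases h.nextAdj_star hv hb with hb' | ⟨w', hc', rfl⟩
  · exact h.inj ha' hb' hab
  · exact absurd hab (hc'.2.2.2 a ha')
  · exact absurd hab.symm (hc.2.2.2 b hb')
  · rw [dproj_newVert, dproj_newVert] at hab
    rw [hab]

theorem star_full (hv : v ∈ D.verts) (ha : Y.NextAdj v₀ n D v a) (hb : Y.NextAdj v₀ n D v b)
    (ht : Y.Tri (dproj v₀ v) (dproj v₀ a) (dproj v₀ b)) : Y.NextAdj v₀ n D a b := by
  have mixed : ∀ {a b : List V}, D.adj v a → 
      (∃ w, Y.Cand v₀ n D v w ∧ b = Y.newVert v₀ n D v w) →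
      Y.Tri (dproj v₀ v) (dproj v₀ a) (dproj v₀ b) → Y.NextAdj v₀ n D a b := by
    rintro a b ha ⟨w, hc, rfl⟩ ht
    have hl := h.length_le (h.right_mem ha)
    rcases hl.lt_or_eq with hl | hl
    · exact absurd ht (h.not_tri_of_length_lt hc (h.symm ha) hl)
    · have hca := h.cand_of_adj hc (h.symm ha) hl ht.swap_left
      rw [← h.newVert_congr hY hc ⟨hca, .inr ⟨h.symm ha, ht.swap_left⟩⟩]
      exact .up hca
  rcases h.nextAdj_star hv ha with ha' | ⟨w, hc, rfl⟩
  · rcases h.nextAdj_star hv hb with hb' | hb'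
    · exact .old (h.full ha' hb' ht)
    · exact mixed ha' hb' ht
  · rcases h.nextAdj_star hv hb with hb' | ⟨w', hcw, rfl⟩
    · exact h.nextAdj_symm (mixed hb' ⟨w, hc, rfl⟩ ht.swap)
    · exact .side hc hcw ht

/-- Every member of the class of a new vertex is adjacent to it. -/
theorem candClass_adj (hu : u ∈ Y.candClass v₀ n D v w) (hc : Y.Cand v₀ n D v w) :
    Y.NextAdj v₀ n D u (Y.newVert v₀ n D v w) := by
  rw [← h.newVert_congr hY hc hu]
  exact .up hu.1

theorem adj_of_mem_candClass (ha : a ∈ Y.candClass v₀ n D v w) (hb : b ∈ Y.candClass v₀ n D v w)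
    (hc : Y.Cand v₀ n D v w) (hab : a ≠ b) : D.adj a b := by
  rcases (h.candClass_trans hY (h.candClass_symm hc hb) ha).2 with hadj | hadj
  · exact absurd hadj hab
  · exact hadj.1

theorem tri_of_mem_candClass (ha : a ∈ Y.candClass v₀ n D v w) (hb : b ∈ Y.candClass v₀ n D v w)
    (hc : Y.Cand v₀ n D v w) (hab : a ≠ b) : Y.Tri (dproj v₀ a) (dproj v₀ b) w := by
  rcases (h.candClass_trans hY (h.candClass_symm hc hb) ha).2 with hadj | hadj
  · exact absurd hadj hab
  · exact hadj.2

/-- A triangle of new vertices lies in the star of an old vertex. -/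
theorem exists_pivot {a b c : List V} {p q r : V} (ha : Y.Cand v₀ n D a p)
    (hb : Y.Cand v₀ n D b q) (hc : Y.Cand v₀ n D c r)
    (hab : Y.NextAdj v₀ n D (Y.newVert v₀ n D a p) (Y.newVert v₀ n D b q))
    (hac : Y.NextAdj v₀ n D (Y.newVert v₀ n D a p) (Y.newVert v₀ n D c r))
    (hbc : Y.NextAdj v₀ n D (Y.newVert v₀ n D b q) (Y.newVert v₀ n D c r)) :
    ∃ u, u ∈ Y.candClass v₀ n D a p ∧ u ∈ Y.candClass v₀ n D b q ∧
      u ∈ Y.candClass v₀ n D c r := by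
  obtain ⟨s, hsa, hsb, hs⟩ := h.nextAdj_newVert_newVert hY ha hb hab
  obtain ⟨t, hta, htc, ht⟩ := h.nextAdj_newVert_newVert hY ha hc hac
  obtain ⟨u, hub, huc, hu⟩ := h.nextAdj_newVert_newVert hY hb hc hbc
  by_cases hst : s = t
  · exact ⟨s, hsa, hsb, hst ▸ htc⟩
  by_cases hsu : s = u
  · exact ⟨s, hsa, hsb, hsu ▸ huc⟩
  by_cases htu : t = u
  · exact ⟨t, hta, htu ▸ hub, htc⟩
  have hst' := h.adj_of_mem_candClass hY hsa hta ha hst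
  have hsu' := h.adj_of_mem_candClass hY hsb hub hb hsu
  have htu' := h.adj_of_mem_candClass hY htc huc hc htu
  have h₁ := h.tri_of_mem_candClass hY hsa hta ha hst
  have h₂ := h.tri_of_mem_candClass hY hsb hub hb hsu
  have hp : dproj v₀ t ≠ q := fun he => hsb.1.2.2.2 t hst' he
  have hq : p ≠ dproj v₀ u := fun he => hsa.1.2.2.2 u hsu' he.symm
  rcases hY.four h₁ hs h₂.swap (h.tri hsu' hst' (h.symm htu')) hp hq with h' | h'
  · refine ⟨t, hta, h.candClass_trans hY hsb ⟨?_, .inr ⟨h.symm hst', h'.swap_left⟩⟩, htc⟩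
    exact h.cand_of_adj hsb.1 (h.symm hst') hta.1.2.1 h'.swap_left
  · refine ⟨u, h.candClass_trans hY hsa ⟨?_, .inr ⟨h.symm hsu', h'.swap.swap_left⟩⟩, hub, huc⟩
    exact h.cand_of_adj hsa.1 (h.symm hsu') hub.1.2.1 h'.swap.swap_left

omit hY in
theorem nextAdj_cases (hab : Y.NextAdj v₀ n D a b) :
    a ∈ D.verts ∨ ∃ v w, Y.Cand v₀ n D v w ∧ a = Y.newVert v₀ n D v w := by
  cases hab with
  | old h' => exact .inl (h.left_mem h')
  | up hc => exact .inl hc.1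
  | down hc => exact .inr ⟨_, _, hc, rfl⟩
  | side hc hc' ht => exact .inr ⟨_, _, hc, rfl⟩

theorem next_tri (ha : Y.NextAdj v₀ n D v a) (hb : Y.NextAdj v₀ n D v b)
    (hab : Y.NextAdj v₀ n D a b) : Y.Tri (dproj v₀ v) (dproj v₀ a) (dproj v₀ b) := by
  rcases h.nextAdj_cases ha with hv | ⟨v', p, hv, rfl⟩
  · exact h.star_tri hY hv ha hb hab
  rcases h.nextAdj_cases hab with ha' | ⟨a', q, ha', rfl⟩
  · exact (h.star_tri hY ha' (h.nextAdj_symm ha) hab hb).swap_left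
  rcases h.nextAdj_cases (h.nextAdj_symm hab) with hb' | ⟨b', r, hb', rfl⟩
  · exact (h.star_tri hY hb' (h.nextAdj_symm hb) (h.nextAdj_symm hab) ha).rotate
  obtain ⟨u, hu₁, hu₂, hu₃⟩ := h.exists_pivot hY hv ha' hb' ha hb hab
  have h₁ := h.candClass_adj hY hu₁ hv
  have h₂ := h.candClass_adj hY hu₂ ha'
  have h₃ := h.candClass_adj hY hu₃ hb'
  exact hY.tetra (h.star_tri hY hu₁.1.1 h₁ h₂ ha) (h.star_tri hY hu₁.1.1 h₁ h₃ hb)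
    (h.star_tri hY hu₁.1.1 h₂ h₃ hab)

theorem next_inj (ha : Y.NextAdj v₀ n D v a) (hb : Y.NextAdj v₀ n D v b)
    (hab : dproj v₀ a = dproj v₀ b) : a = b := by
  rcases h.nextAdj_cases ha with hv | ⟨v', p, hv, rfl⟩
  · exact h.star_inj hv ha hb hab
  have mixed : ∀ {a b : List V}, a ∈ D.verts →
      (∃ m q, Y.Cand v₀ n D m q ∧ b = Y.newVert v₀ n D m q) →
      Y.NextAdj v₀ n D (Y.newVert v₀ n D v' p) a → Y.NextAdj v₀ n D (Y.newVert v₀ n D v' p) b →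
      dproj v₀ a ≠ dproj v₀ b := by
    rintro a _ ha ⟨m, q, hc, rfl⟩ hxa hxb he
    obtain ⟨s, hs₁, hs₂, hs⟩ := h.nextAdj_newVert_newVert hY hv hc hxb
    have ha' := h.nextAdj_newVert_of_mem hY hv ha hxa
    have hsn := h.candClass_adj hY hs₂ hc
    by_cases hsa : s = a
    · subst hsa
      exact (h.nextAdj_edge hsn).1 he
    · exact hs₂.1.2.2.2 a (h.adj_of_mem_candClass hY hs₁ ha' hv hsa) he
  rcases h.nextAdj_cases (h.nextAdj_symm ha) with ha' | ⟨a', q, ha', rfl⟩ <;>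
    rcases h.nextAdj_cases (h.nextAdj_symm hb) with hb' | ⟨b', r, hb', rfl⟩
  · by_contra hne
    have := h.adj_of_mem_candClass hY (h.nextAdj_newVert_of_mem hY hv ha' ha)
      (h.nextAdj_newVert_of_mem hY hv hb' hb) hv hne
    exact (h.edge this).1 hab
  · exact absurd hab (mixed ha' ⟨_, _, hb', rfl⟩ ha hb)
  · exact absurd hab.symm (mixed hb' ⟨_, _, ha', rfl⟩ hb ha)
  · rw [dproj_newVert, dproj_newVert] at hab
    subst hab
    obtain ⟨s, hs₁, hs₂, hs⟩ := h.nextAdj_newVert_newVert hY hv ha' ha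
    obtain ⟨t, ht₁, ht₂, ht⟩ := h.nextAdj_newVert_newVert hY hv hb' hb
    have hsn := h.candClass_adj hY hs₂ ha'
    have htn := h.candClass_adj hY ht₂ hb'
    by_cases hst : s = t
    · subst hst
      exact h.star_inj hs₁.1.1 hsn htn rfl
    · have hadj := h.adj_of_mem_candClass hY hs₁ ht₁ hv hst
      have htri := (h.tri_of_mem_candClass hY hs₁ ht₁ hv hst)
      have := hY.tetra htri.swap.swap_left hs.swap_left ht.swap_left
      have := h.star_full hY hs₁.1.1 (.old hadj) hsn this
      exact h.star_inj ht₁.1.1 this htn rfl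

theorem next_full (ha : Y.NextAdj v₀ n D v a) (hb : Y.NextAdj v₀ n D v b)
    (hab : Y.Tri (dproj v₀ v) (dproj v₀ a) (dproj v₀ b)) : Y.NextAdj v₀ n D a b := by
  rcases h.nextAdj_cases ha with hv | ⟨v', p, hv, rfl⟩
  · exact h.star_full hY hv ha hb hab
  have mixed : ∀ {a b : List V}, a ∈ D.verts →
      (∃ m q, Y.Cand v₀ n D m q ∧ b = Y.newVert v₀ n D m q) →
      Y.NextAdj v₀ n D (Y.newVert v₀ n D v' p) a → Y.NextAdj v₀ n D (Y.newVert v₀ n D v' p) b →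
      Y.Tri p (dproj v₀ a) (dproj v₀ b) → Y.NextAdj v₀ n D a b := by
    rintro a _ ha ⟨m, q, hc, rfl⟩ hxa hxb ht
    obtain ⟨s, hs₁, hs₂, hs⟩ := h.nextAdj_newVert_newVert hY hv hc hxb
    have ha' := h.nextAdj_newVert_of_mem hY hv ha hxa
    have hsn := h.candClass_adj hY hs₂ hc
    by_cases hsa : s = a
    · subst hsa
      exact hsn
    · have hadj := h.adj_of_mem_candClass hY hs₁ ha' hv hsa
      have htri := h.tri_of_mem_candClass hY hs₁ ha' hv hsa
      exact h.star_full hY hs₁.1.1 (.old hadj) hsn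
        (hY.tetra htri.swap.swap_left hs.swap_left ht)
  -- two new neighbours `y`, `z` with a common old neighbour `s` of `x`, `z`, and `y` adjacent to `s`
  have close : ∀ {y z s t : List V}, s ∈ Y.candClass v₀ n D v' p → t ∈ Y.candClass v₀ n D v' p →
      s ≠ t → Y.NextAdj v₀ n D s y → Y.NextAdj v₀ n D t z →
      Y.NextAdj v₀ n D (Y.newVert v₀ n D v' p) y → Y.NextAdj v₀ n D (Y.newVert v₀ n D v' p) z →
      Y.Tri p (dproj v₀ y) (dproj v₀ z) → Y.Tri p (dproj v₀ s) (dproj v₀ z) →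
      Y.NextAdj v₀ n D y z := by
    intro y z s t hs ht hst hsy htz hxy hxz hyz hsz
    have hxs := h.candClass_adj hY hs hv
    have hxt := h.candClass_adj hY ht hv
    have hts := h.adj_of_mem_candClass hY ht hs hv (Ne.symm hst)
    have htri := h.tri_of_mem_candClass hY ht hs hv (Ne.symm hst)
    have hsz' := h.star_full hY ht.1.1 (.old hts) htz
      (hY.tetra htri.swap.swap_left (h.star_tri hY ht.1.1 hxt htz hxz).swap_left hsz)
    exact h.star_full hY hs.1.1 hsy hsz'
      (hY.tetra (h.star_tri hY hs.1.1 hxs hsy hxy).swap_left hsz hyz)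
  rcases h.nextAdj_cases (h.nextAdj_symm ha) with ha' | ⟨a', q, ha', rfl⟩ <;>
    rcases h.nextAdj_cases (h.nextAdj_symm hb) with hb' | ⟨b', r, hb', rfl⟩
  · refine .old (h.adj_of_mem_candClass hY (h.nextAdj_newVert_of_mem hY hv ha' ha)
      (h.nextAdj_newVert_of_mem hY hv hb' hb) hv ?_)
    rintro rfl
    exact hab.2.2.1 rfl
  · exact mixed ha' ⟨_, _, hb', rfl⟩ ha hb hab
  · exact h.nextAdj_symm (mixed hb' ⟨_, _, ha', rfl⟩ hb ha hab.swap)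
  · obtain ⟨s, hs₁, hs₂, hs⟩ := h.nextAdj_newVert_newVert hY hv ha' ha
    obtain ⟨t, ht₁, ht₂, ht⟩ := h.nextAdj_newVert_newVert hY hv hb' hb
    have hsn := h.candClass_adj hY hs₂ ha'
    have htn := h.candClass_adj hY ht₂ hb'
    by_cases hst : s = t
    · subst hst
      exact h.star_full hY hs₁.1.1 hsn htn (hY.tetra hs.swap_left ht.swap_left hab)
    · have hadj := h.adj_of_mem_candClass hY hs₁ ht₁ hv hst
      have htri := h.tri_of_mem_candClass hY hs₁ ht₁ hv hst
      have h₁ : dproj v₀ s ≠ r := by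
        intro he
        exact ht₂.1.2.2.2 s (h.symm hadj) he
      have h₂ : dproj v₀ t ≠ q := fun he => hs₂.1.2.2.2 t hadj he
      rcases hY.four htri.swap.swap_left ht.swap_left hab.swap hs.swap_left.swap h₁ h₂ with h' | h'
      · exact close hs₁ ht₁ hst hsn htn ha hb hab h'
      · exact h.nextAdj_symm
          (close ht₁ hs₁ (Ne.symm hst) htn hsn hb ha hab.swap h')

theorem next : Y.DevInv v₀ (n + 1) (Y.nextDev v₀ n D) where
  length_le := by
    rintro a (ha | ⟨v, w, hc, rfl⟩)
    · exact (h.length_le ha).trans (Nat.le_succ _)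
    · exact (length_newVert hc).le
  symm := h.nextAdj_symm
  left_mem hab := (h.nextAdj_cases hab).imp id id
  edge := h.nextAdj_edge
  level := h.nextAdj_level
  tri := h.next_tri hY
  inj := h.next_inj hY
  full := h.next_full hY
  lift := by
    rintro v w (hv | ⟨u, q, hc, rfl⟩) hl hE
    · by_cases hw : ∃ a, D.adj v a ∧ dproj v₀ a = w
      · obtain ⟨a, ha, hw⟩ := hw
        exact ⟨a, .old ha, hw⟩
      · have hn : v.length = n := by
          by_contra hne
          have := h.length_le hv
          exact hw (h.lift hv (by omega) hE)
        push Not at hw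
        exact ⟨_, .up ⟨hv, hn, hE, hw⟩, rfl⟩
    · rw [length_newVert hc] at hl
      omega
  father := by
    rintro w v (hv | ⟨u, q, hc, he⟩)
    · exact .old (h.father hv)
    · obtain ⟨m, hm, hme, -⟩ := exists_newVert_eq hc
      obtain ⟨rfl, rfl⟩ := List.cons.inj (he.trans hme)
      rw [he]
      exact h.nextAdj_symm (h.candClass_adj hY hm hc)
  father_le := by
    intro w v u hvu hl
    rcases h.nextAdj_cases hvu with hv | ⟨s, q, hc, he⟩
    · rcases h.nextAdj_star hv hvu with h' | ⟨q, hc, rfl⟩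
      · exact h.father_le h' hl
      · have := hc.2.1
        rw [length_newVert hc] at hl
        simp at this
        omega
    · obtain ⟨m, hm, hme, hmin⟩ := exists_newVert_eq hc
      obtain ⟨rfl, rfl⟩ := List.cons.inj (he.trans hme)
      rw [he] at hvu
      refine hmin u (h.nextAdj_newVert_of_mem hY hc ?_ hvu)
      rcases h.nextAdj_cases (h.nextAdj_symm hvu) with hu | ⟨t, r, hc', rfl⟩
      · exact hu
      · rw [length_newVert hc', hm.1.2.1] at hl
        omega
  clique := by
    intro x a b hxa hxb ha hb hab
    have old : ∀ {a}, Y.NextAdj v₀ n D x a → a.length + 1 = x.length → a ∈ D.verts := by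
      intro a hxa ha
      rcases h.nextAdj_cases (h.nextAdj_symm hxa) with h' | ⟨t, r, hc, rfl⟩
      · exact h'
      · exfalso
        rw [length_newVert hc] at ha
        rcases h.nextAdj_cases hxa with h' | ⟨t', r', hc', rfl⟩
        · have := h.length_le h'
          omega
        · rw [length_newVert hc'] at ha
          omega
    have ha' := old hxa ha
    have hb' := old hxb hb
    rcases h.nextAdj_cases hxa with hx | ⟨t, r, hc, rfl⟩
    · exact .old (h.clique (h.nextAdj_old hx ha' hxa) (h.nextAdj_old hx hb' hxb) ha hb hab)
    · exact .old (h.adj_of_mem_candClass hY (h.nextAdj_newVert_of_mem hY hc ha' hxa)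
        (h.nextAdj_newVert_of_mem hY hc hb' hxb) hc hab)
  common := by
    intro a b hab hl
    cases hab with
    | old h' =>
      obtain ⟨u, h₁, h₂, h₃⟩ := h.common h' hl
      exact ⟨u, .old h₁, .old h₂, h₃⟩
    | up hc =>
      rw [length_newVert hc, hc.2.1] at hl
      omega
    | down hc =>
      rw [length_newVert hc, hc.2.1] at hl
      omega
    | @side v _ _ hc hc' ht =>
      exact ⟨v, .up hc, .up hc', by rw [length_newVert hc, hc.2.1]⟩

end DevInv

theorem devInv_stage (hY : Y.SixLargeLinks) (v₀ : V) (n : ℕ) :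
    Y.DevInv v₀ n (Y.stage v₀ n) := by
  induction n with
  | zero => constructor <;> simp [stage]
  | succ n ih => exact ih.next hY

end Stages

/-- A graph `A` on a well-ordered set `T` developing the complex `Y`: the projection `p` is
bijective from the star of each vertex `t` onto the star of `p t`, and every `t ≠ o` is dominated
in the set of its predecessors by the smaller vertex `f t`. -/
structure Development {V : Type u} [DecidableEq V] (Y : SComplex V) {T : Type u} [LinearOrder T]
    (A : T → T → Prop) (p : T → V) (f : T → T) (o : T) : Prop where
  symm : ∀ {a b}, A a b → A b a
  mem : ∀ t, {p t} ∈ Y.faces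
  edge : ∀ {a b}, A a b → Y.Edge (p a) (p b)
  inj : ∀ {t a b}, A t a → A t b → p a = p b → a = b
  tri : ∀ {t a b}, A t a → A t b → (A a b ↔ Y.Tri (p t) (p a) (p b))
  lift : ∀ {t w}, Y.Edge (p t) w → ∃ a, A t a ∧ p a = w
  adj_f : ∀ {t}, t ≠ o → A t (f t)
  f_lt : ∀ {t}, t ≠ o → f t < t
  dominated : ∀ {t x}, t ≠ o → A x t → x < t → x = f t ∨ A x (f t)

section Union

variable {V : Type u} [DecidableEq V] {Y : SComplex V} {v₀ : V} {m n : ℕ} {a b t u x : List V}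
  {w : V}

theorem stage_verts_mono (hmn : m ≤ n) : (Y.stage v₀ m).verts ⊆ (Y.stage v₀ n).verts := by
  induction n, hmn using Nat.le_induction with
  | base => exact subset_rfl
  | succ n _ ih => exact fun a ha => .inl (ih ha)

theorem stage_adj_mono (hmn : m ≤ n) (h : (Y.stage v₀ m).adj a b) : (Y.stage v₀ n).adj a b := by
  induction n, hmn using Nat.le_induction with
  | base => exact h
  | succ n _ ih => exact .old ih

/-- The vertices of the full development. -/
def devVerts (Y : SComplex V) (v₀ : V) : Set (List V) := {l | ∃ n, l ∈ (Y.stage v₀ n).verts}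

/-- Adjacency in the full development. -/
def devAdj (Y : SComplex V) (v₀ : V) (a b : List V) : Prop := ∃ n, (Y.stage v₀ n).adj a b

theorem exists_stage_two (hx : Y.devAdj v₀ x t) (hu : Y.devAdj v₀ u a) :
    ∃ n, (Y.stage v₀ n).adj x t ∧ (Y.stage v₀ n).adj u a := by
  obtain ⟨n₁, h₁⟩ := hx
  obtain ⟨n₂, h₂⟩ := hu
  exact ⟨max n₁ n₂, stage_adj_mono (le_max_left _ _) h₁, stage_adj_mono (le_max_right _ _) h₂⟩

theorem exists_stage_three (hx : Y.devAdj v₀ x t) (hu : Y.devAdj v₀ u a) {c d : List V}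
    (hc : Y.devAdj v₀ c d) :
    ∃ n, (Y.stage v₀ n).adj x t ∧ (Y.stage v₀ n).adj u a ∧ (Y.stage v₀ n).adj c d := by
  obtain ⟨n₁, h₁, h₂⟩ := exists_stage_two hx hu
  obtain ⟨n₂, h₃⟩ := hc
  exact ⟨max n₁ n₂, stage_adj_mono (le_max_left _ _) h₁, stage_adj_mono (le_max_left _ _) h₂,
    stage_adj_mono (le_max_right _ _) h₃⟩

section

variable (hY : Y.SixLargeLinks)
include hY

theorem devAdj_symm (h : Y.devAdj v₀ a b) : Y.devAdj v₀ b a := by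
  obtain ⟨n, h⟩ := h
  exact ⟨n, (devInv_stage hY v₀ n).symm h⟩

theorem devAdj_edge (h : Y.devAdj v₀ a b) : Y.Edge (dproj v₀ a) (dproj v₀ b) := by
  obtain ⟨n, h⟩ := h
  exact (devInv_stage hY v₀ n).edge h

theorem devAdj_left_mem (h : Y.devAdj v₀ a b) : a ∈ Y.devVerts v₀ := by
  obtain ⟨n, h⟩ := h
  exact ⟨n, (devInv_stage hY v₀ n).left_mem h⟩

theorem devAdj_inj (ha : Y.devAdj v₀ t a) (hb : Y.devAdj v₀ t b)
    (he : dproj v₀ a = dproj v₀ b) : a = b := by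
  obtain ⟨n, h₁, h₂⟩ := exists_stage_two ha hb
  exact (devInv_stage hY v₀ n).inj h₁ h₂ he

theorem devAdj_tri (ha : Y.devAdj v₀ t a) (hb : Y.devAdj v₀ t b) :
    Y.devAdj v₀ a b ↔ Y.Tri (dproj v₀ t) (dproj v₀ a) (dproj v₀ b) := by
  constructor
  · intro hab
    obtain ⟨n, h₁, h₂, h₃⟩ := exists_stage_three ha hb hab
    exact (devInv_stage hY v₀ n).tri h₁ h₂ h₃
  · intro ht
    obtain ⟨n, h₁, h₂⟩ := exists_stage_two ha hb
    exact ⟨n, (devInv_stage hY v₀ n).full h₁ h₂ ht⟩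

theorem devAdj_lift (ht : t ∈ Y.devVerts v₀) (hw : Y.Edge (dproj v₀ t) w) :
    ∃ a, Y.devAdj v₀ t a ∧ dproj v₀ a = w := by
  obtain ⟨n, hn⟩ := ht
  obtain ⟨a, h₁, h₂⟩ := (devInv_stage hY v₀ (max n (t.length + 1))).lift
    (stage_verts_mono (le_max_left _ _) hn) (by omega) hw
  exact ⟨a, ⟨_, h₁⟩, h₂⟩

theorem devAdj_father (ht : w :: a ∈ Y.devVerts v₀) : Y.devAdj v₀ (w :: a) a := by
  obtain ⟨n, hn⟩ := ht
  exact ⟨n, (devInv_stage hY v₀ n).father hn⟩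

theorem devAdj_father_le (ht : Y.devAdj v₀ (w :: a) u) (hl : u.length = a.length) :
    a = u ∨ RevShortlex a u := by
  obtain ⟨n, hn⟩ := ht
  rcases trichotomous_of RevShortlex a u with h | h | h
  · exact .inr h
  · exact .inl h
  · exact absurd h ((devInv_stage hY v₀ n).father_le hn hl)

theorem devAdj_clique (ha : Y.devAdj v₀ t a) (hb : Y.devAdj v₀ t b) (hal : a.length + 1 = t.length)
    (hbl : b.length + 1 = t.length) : a = b ∨ Y.devAdj v₀ a b := by
  obtain ⟨n, h₁, h₂⟩ := exists_stage_two ha hb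
  rw [or_iff_not_imp_left]
  exact fun hab => ⟨n, (devInv_stage hY v₀ n).clique h₁ h₂ hal hbl hab⟩

theorem devAdj_common (ha : Y.devAdj v₀ a b) (hl : a.length = b.length) :
    ∃ u, Y.devAdj v₀ u a ∧ Y.devAdj v₀ u b ∧ u.length + 1 = a.length := by
  obtain ⟨n, h₁⟩ := ha
  obtain ⟨u, h₂, h₃, h₄⟩ := (devInv_stage hY v₀ n).common h₁ hl
  exact ⟨u, ⟨n, h₂⟩, ⟨n, h₃⟩, h₄⟩

theorem devAdj_level (ha : Y.devAdj v₀ a b) : b.length ≤ a.length + 1 := by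
  obtain ⟨n, h₁⟩ := ha
  exact (devInv_stage hY v₀ n).level h₁

theorem devAdj_dominated (n : ℕ) : ∀ {t x : List V}, t.length = n → t ≠ [] →
    Y.devAdj v₀ x t → RevShortlex x t → x = t.tail ∨ Y.devAdj v₀ x t.tail := by
  induction n using Nat.strong_induction_on with
  | _ n ih =>
  intro t x hn ht hxt hlt
  obtain ⟨w, a, rfl⟩ := List.exists_cons_of_ne_nil ht
  rw [List.tail_cons]
  have htx := devAdj_symm hY hxt
  have hta : Y.devAdj v₀ (w :: a) a := devAdj_father hY (devAdj_left_mem hY htx)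
  have hat := devAdj_symm hY hta
  rcases lt_or_eq_of_le hlt.length_le with hl | hl
  · have := devAdj_level hY hxt
    exact devAdj_clique hY htx hta (by simp at *; omega) (by simp)
  cases x with
  | nil => simp at hl
  | cons w' b =>
  have hba : b.length = a.length := by simpa using hl
  have hxb : Y.devAdj v₀ (w' :: b) b := devAdj_father hY (devAdj_left_mem hY hxt)
  have hbx := devAdj_symm hY hxb
  rcases hlt.tail hba with hab | rfl
  swap
  · exact .inr hxb
  right
  by_contra hnxa
  have hntb : ¬ Y.devAdj v₀ (w :: a) b := by
    intro htb
    rcases devAdj_father_le hY htb hba with rfl | h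
    · exact absurd hab (irrefl _)
    · exact absurd hab (asymm_of RevShortlex h)
  obtain ⟨u, hux, hut, hul⟩ := devAdj_common hY hxt hl
  have hxu := devAdj_symm hY hux
  have htu := devAdj_symm hY hut
  have hub : u ≠ b := by rintro rfl; exact hntb htu
  have hua : u ≠ a := by rintro rfl; exact hnxa hxu
  have hul' : u.length = a.length := by simp at hul; omega
  have hbu : Y.devAdj v₀ b u := (devAdj_clique hY hxb hxu (by simp) hul).resolve_left hub.symm
  have hau : Y.devAdj v₀ a u :=
    (devAdj_clique hY hta htu (by simp) (by simp [hul'])).resolve_left hua.symm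
  have hub' := devAdj_symm hY hbu
  have hua' := devAdj_symm hY hau
  have hbltu := (devAdj_father_le hY hxu (by omega)).resolve_left hub.symm
  have haltu := (devAdj_father_le hY htu (by omega)).resolve_left hua.symm
  have ne : ∀ {c d : List V}, Y.devAdj v₀ u c → Y.devAdj v₀ u d → c ≠ d →
      dproj v₀ c ≠ dproj v₀ d := fun h₁ h₂ h₃ h₄ => h₃ (devAdj_inj hY h₁ h₂ h₄)
  have nlen : ∀ {c d : List V}, c.length ≠ d.length → c ≠ d := fun h₁ h₂ => h₁ (by rw [h₂])
  have tri := fun {c d : List V} (h₁ : Y.devAdj v₀ u c) (h₂ : Y.devAdj v₀ u d) =>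
    devAdj_tri hY h₁ h₂
  have hnab : ¬ Y.devAdj v₀ a b := by
    intro h
    have hne : a ≠ b := by rintro rfl; exact absurd hab (irrefl _)
    rcases hY.four ((tri hub' hux).1 hbx) ((tri hux hut).1 hxt) ((tri hut hua').1 hta)
      ((tri hua' hub').1 h) (ne hub' hut (nlen (by simp; omega)))
      (ne hux hua' (nlen (by simp; omega))) with h' | h'
    · exact hntb (devAdj_symm hY ((tri hub' hut).2 h'))
    · exact hnxa ((tri hux hua').2 h')
  have hune : u ≠ [] := by
    rintro rfl
    have h₁ : a = [] := by rw [← List.length_eq_zero_iff, ← hul']; rfl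
    exact hua h₁.symm
  obtain ⟨w'', c, rfl⟩ := List.exists_cons_of_ne_nil hune
  have huc : Y.devAdj v₀ (w'' :: c) c := devAdj_father hY (devAdj_left_mem hY hux)
  rw [List.length_cons] at hn
  have hac := ih a.length (by omega) hul' hune hau haltu
  have hbc := ih a.length (by omega) hul' hune hbu hbltu
  simp only [List.length_cons] at hul hul'
  rw [List.tail_cons] at hac hbc
  have hac' := hac.resolve_left (nlen (by omega))
  have hbc' := hbc.resolve_left (nlen (by omega))
  have hcx : ¬ Y.devAdj v₀ c (w' :: b) := fun h => by
    have := devAdj_level hY h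
    simp at this
    omega
  have hct : ¬ Y.devAdj v₀ c (w :: a) := fun h => by
    have := devAdj_level hY h
    simp at this
    omega
  have hne : b ≠ a := by rintro rfl; exact absurd hab (irrefl _)
  rcases hY.five ((tri hub' hux).1 hbx) ((tri hux hut).1 hxt) ((tri hut hua').1 hta)
    ((tri hua' huc).1 hac') ((tri huc hub').1 (devAdj_symm hY hbc'))
    (ne hub' hut (nlen (by simp; omega))) (ne hux hua' (nlen (by simp; omega)))
    (ne hut huc (nlen (by simp; omega))) (ne hua' hub' hne.symm)
    (ne huc hux (nlen (by simp; omega))) with h' | h' | h' | h' | h'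
  · exact hntb (devAdj_symm hY ((tri hub' hut).2 h'))
  · exact hnxa ((tri hux hua').2 h')
  · exact hct (devAdj_symm hY ((tri hut huc).2 h'))
  · exact hnab ((tri hua' hub').2 h')
  · exact hcx ((tri huc hux).2 h')

theorem mem_of_mem_devVerts (hv : {v₀} ∈ Y.faces) (h : t ∈ Y.devVerts v₀) :
    {dproj v₀ t} ∈ Y.faces := by
  cases t with
  | nil => exact hv
  | cons w a => exact (devAdj_edge hY (devAdj_father hY h)).left_mem

end

/-- The development of a complex with large links, based at a vertex. -/
theorem SixLargeLinks.exists_development (hY : Y.SixLargeLinks) (hv : {v₀} ∈ Y.faces) :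
    ∃ (T : Type u) (_ : LinearOrder T) (A : T → T → Prop) (p : T → V) (f : T → T) (o : T),
      WellFoundedLT T ∧ p o = v₀ ∧ Y.Development A p f o := by
  classical
  let T := {l : List V // l ∈ Y.devVerts v₀}
  let : LinearOrder (List V) := linearOrderOfSTO RevShortlex
  have hlt : ∀ {a b : List V}, a < b ↔ RevShortlex a b := Iff.rfl
  have : WellFoundedLT (List V) := ⟨wellFounded_revShortlex⟩
  have htail : ∀ t ∈ Y.devVerts v₀, t.tail ∈ Y.devVerts v₀ := by
    rintro (_ | ⟨w, a⟩) h
    · exact h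
    · exact devAdj_left_mem hY (devAdj_symm hY (devAdj_father hY h))
  have hcons : ∀ {t : T}, t ≠ ⟨[], 0, rfl⟩ → t.1 ≠ [] := fun h h' => h (Subtype.ext h')
  refine ⟨T, inferInstance, fun a b => Y.devAdj v₀ a.1 b.1, fun t => dproj v₀ t.1,
    fun t => ⟨t.1.tail, htail _ t.2⟩, ⟨[], 0, rfl⟩, inferInstance, rfl, ?_⟩
  refine ⟨devAdj_symm hY, fun t => mem_of_mem_devVerts hY hv t.2, devAdj_edge hY,
    fun h₁ h₂ h₃ => Subtype.ext (devAdj_inj hY h₁ h₂ h₃), devAdj_tri hY, ?_, ?_, ?_, ?_⟩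
  · intro t w h
    obtain ⟨a, h₁, h₂⟩ := devAdj_lift hY t.2 h
    exact ⟨⟨a, devAdj_left_mem hY (devAdj_symm hY h₁)⟩, h₁, h₂⟩
  · rintro ⟨t, ht⟩ h
    obtain ⟨w, a, rfl⟩ := List.exists_cons_of_ne_nil (hcons h)
    exact devAdj_father hY ht
  · rintro ⟨t, ht⟩ h
    obtain ⟨w, a, rfl⟩ := List.exists_cons_of_ne_nil (hcons h)
    exact hlt.2 (.of_length_lt (by simp))
  · rintro ⟨t, ht⟩ ⟨x, hx⟩ h hxt hl
    rcases devAdj_dominated hY _ rfl (hcons h) hxt (hlt.1 hl) with h' | h'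
    · exact .inl (Subtype.ext h')
    · exact .inr h'

end Union

section Realization

variable {V : Type u} {Y : SComplex V} {g : V → ℝ} {v : V}

theorem exists_support (hg : g ∈ Y.realization) :
    ∃ σ ∈ Y.faces, (∀ v, v ∈ σ ↔ g v ≠ 0) ∧ ∑ v ∈ σ, g v = 1 := by
  classical
  obtain ⟨-, σ, hσ, h0, h1⟩ := hg
  have hs : ∑ v ∈ σ with g v ≠ 0, g v = 1 := by rw [Finset.sum_filter_ne_zero, h1]
  refine ⟨σ.filter (g · ≠ 0), Y.down_closed _ hσ _ (Finset.filter_subset _ _) ?_, ?_, hs⟩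
  · by_contra h
    rw [Finset.not_nonempty_iff_eq_empty] at h
    simp [h] at hs
  · intro v
    rw [Finset.mem_filter, and_iff_right_iff_imp]
    exact fun h => by_contra fun h' => h (h0 v h')

theorem exists_ne_zero (hg : g ∈ Y.realization) : ∃ v, g v ≠ 0 := by
  obtain ⟨σ, hσ, hs, -⟩ := exists_support hg
  obtain ⟨v, hv⟩ := Y.nonempty_of_mem σ hσ
  exact ⟨v, (hs v).1 hv⟩

theorem isOpen_coord_ne_zero (Y : SComplex V) (v : V) :
    IsOpen {g : Y.realization | g.1 v ≠ 0} :=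
  isOpen_ne_fun ((continuous_apply v).comp continuous_subtype_val) continuous_const

end Realization

/-- The clique complex of a relation. -/
def cliqueComplex {T : Type u} (A : T → T → Prop) : SComplex T where
  faces := {σ | σ.Nonempty ∧ ∀ a ∈ σ, ∀ b ∈ σ, a ≠ b → A a b}
  nonempty_of_mem := fun _ h => h.1
  down_closed := fun _ h _ hτ hne => ⟨hne, fun a ha b hb => h.2 a (hτ ha) b (hτ hb)⟩

section Cover

variable {V : Type u} [DecidableEq V] {Y : SComplex V} {T : Type u} [LinearOrder T]
  {A : T → T → Prop} {p : T → V} {f : T → T} {o : T} {h : T → ℝ} {g : V → ℝ} {s t x : T} {w : V}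

open Classical in
/-- The map of realizations induced by a vertex map which is injective on simplices. -/
noncomputable def pushforward (p : T → V) (h : T → ℝ) (w : V) : ℝ :=
  if H : ∃ x, p x = w ∧ h x ≠ 0 then h H.choose else 0

omit [DecidableEq V] [LinearOrder T] in
theorem exists_of_pushforward_ne_zero (hw : pushforward p h w ≠ 0) : ∃ x, p x = w ∧ h x ≠ 0 := by
  by_contra H
  exact hw (dif_neg H)

open Classical in
/-- The lift of a point in the open star of `p t` to the open star of `t`. -/
noncomputable def starLift (A : T → T → Prop) (p : T → V) (t : T) (g : V → ℝ) (x : T) : ℝ :=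
  if x = t ∨ A t x then g (p x) else 0

namespace Development

variable (D : Y.Development A p f o)
include D

theorem star_inj {a b : T} (ha : a = t ∨ A t a) (hb : b = t ∨ A t b) (he : p a = p b) :
    a = b := by
  rcases ha with rfl | ha
  · rcases hb with rfl | hb
    · rfl
    · exact absurd he (D.edge hb).1
  · rcases hb with rfl | hb
    · exact absurd he.symm (D.edge ha).1
    · exact D.inj ha hb he

omit D in
theorem star_of_ne_zero (hh : h ∈ (cliqueComplex A).realization) (ht : h t ≠ 0) (hx : h x ≠ 0) :
    x = t ∨ A t x := by
  obtain ⟨σ, hσ, hs, -⟩ := exists_support hh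
  by_cases hxt : x = t
  · exact .inl hxt
  · exact .inr (hσ.2 t ((hs t).2 ht) x ((hs x).2 hx) (Ne.symm hxt))

theorem eq_of_ne_zero (hh : h ∈ (cliqueComplex A).realization) (ht : h t ≠ 0) (hx : h x ≠ 0)
    (he : p x = p t) : x = t :=
  D.star_inj (star_of_ne_zero hh ht hx) (.inl rfl) he

theorem pushforward_of_ne_zero (hh : h ∈ (cliqueComplex A).realization) (hx : h x ≠ 0) :
    pushforward p h (p x) = h x := by
  have H : ∃ y, p y = p x ∧ h y ≠ 0 := ⟨x, rfl, hx⟩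
  rw [pushforward, dif_pos H, D.eq_of_ne_zero hh hx H.choose_spec.2 H.choose_spec.1]

theorem pushforward_of_star (hh : h ∈ (cliqueComplex A).realization) (ht : h t ≠ 0)
    (hx : x = t ∨ A t x) : pushforward p h (p x) = h x := by
  by_cases hx0 : h x = 0
  · rw [hx0]
    by_contra H
    obtain ⟨y, hy, hy0⟩ := exists_of_pushforward_ne_zero H
    rw [D.star_inj (star_of_ne_zero hh ht hy0) hx hy] at hy0
    exact hy0 hx0
  · exact D.pushforward_of_ne_zero hh hx0

theorem pushforward_mem (hY : Y.SixLargeLinks) (hh : h ∈ (cliqueComplex A).realization) :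
    pushforward p h ∈ Y.realization := by
  classical
  obtain ⟨σ, hσ, hs, h1⟩ := exists_support hh
  have hinj : Set.InjOn p σ := fun a ha b hb he =>
    D.eq_of_ne_zero hh ((hs b).1 hb) ((hs a).1 ha) he
  refine ⟨fun w => ?_, σ.image p, ?_, fun w hw => ?_, ?_⟩
  · by_cases hw : pushforward p h w = 0
    · exact hw.ge
    · obtain ⟨x, rfl, hx⟩ := exists_of_pushforward_ne_zero hw
      rw [D.pushforward_of_ne_zero hh hx]
      exact hh.1 x
  · obtain ⟨t, ht⟩ := hσ.1
    by_cases hne : (σ.erase t).Nonempty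
    · have hA : ∀ a ∈ σ.erase t, A t a := fun a ha =>
        hσ.2 t ht a (Finset.mem_of_mem_erase ha) (Finset.ne_of_mem_erase ha).symm
      rw [← Finset.insert_erase ht, Finset.image_insert]
      refine hY.flag _ _ (hne.image p) ?_ ?_ ?_
      · rw [Finset.mem_image]
        rintro ⟨a, ha, he⟩
        exact (D.edge (hA a ha)).1 he.symm
      · simp only [Finset.forall_mem_image]
        exact fun a ha => D.edge (hA a ha)
      · simp only [Finset.forall_mem_image]
        intro a ha b hb hab
        exact (D.tri (hA a ha) (hA b hb)).1 (hσ.2 a (Finset.mem_of_mem_erase ha) b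
          (Finset.mem_of_mem_erase hb) fun he => hab (by rw [he]))
    · rw [Finset.not_nonempty_iff_eq_empty] at hne
      rw [← Finset.insert_erase ht, hne]
      simpa using D.mem t
  · by_contra hw0
    obtain ⟨x, rfl, hx⟩ := exists_of_pushforward_ne_zero hw0
    exact hw (Finset.mem_image_of_mem p ((hs x).2 hx))
  · rw [Finset.sum_image hinj, ← h1]
    exact Finset.sum_congr rfl fun x hx => D.pushforward_of_ne_zero hh ((hs x).1 hx)

theorem exists_lift_of_ne_zero (hg : g ∈ Y.realization) (ht : g (p t) ≠ 0) (hw : g w ≠ 0) :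
    ∃ x, (x = t ∨ A t x) ∧ p x = w := by
  by_cases hwt : w = p t
  · exact ⟨t, .inl rfl, hwt.symm⟩
  · obtain ⟨σ, hσ, hs, -⟩ := exists_support hg
    obtain ⟨x, hx, rfl⟩ := D.lift (t := t) (w := w) ⟨Ne.symm hwt, Y.down_closed σ hσ _
      (by simp [Finset.insert_subset_iff, hs, ht, hw]) (by simp)⟩
    exact ⟨x, .inr hx, rfl⟩

omit D [DecidableEq V] in
theorem starLift_apply (hx : x = t ∨ A t x) : starLift A p t g x = g (p x) := if_pos hx

omit D [DecidableEq V] in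
theorem star_of_starLift_ne_zero (hx : starLift A p t g x ≠ 0) : x = t ∨ A t x := by
  by_contra H
  exact hx (if_neg H)

theorem starLift_mem (hg : g ∈ Y.realization) (ht : g (p t) ≠ 0) :
    starLift A p t g ∈ (cliqueComplex A).realization := by
  classical
  obtain ⟨σ, hσ, hs, h1⟩ := exists_support hg
  have hex : ∀ w, ∃ x, w ∈ σ → (x = t ∨ A t x) ∧ p x = w := fun w => by
    by_cases hw : w ∈ σ
    · obtain ⟨x, hx⟩ := D.exists_lift_of_ne_zero hg ht ((hs w).1 hw)
      exact ⟨x, fun _ => hx⟩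
    · exact ⟨t, fun h => absurd h hw⟩
  choose l hl using hex
  have hinj : Set.InjOn l σ := fun a ha b hb he => by
    rw [← (hl a ha).2, ← (hl b hb).2, he]
  refine ⟨fun x => ?_, σ.image l, ⟨(Y.nonempty_of_mem σ hσ).image l, ?_⟩, fun x hx => ?_, ?_⟩
  · rw [starLift]
    split_ifs
    exacts [hg.1 _, le_rfl]
  · simp only [Finset.forall_mem_image]
    intro a ha b hb hab
    obtain ⟨ha', hpa⟩ := hl a ha
    obtain ⟨hb', hpb⟩ := hl b hb
    rcases ha' with hat | hat
    · rcases hb' with hbt | hbt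
      · exact absurd (hat.trans hbt.symm) hab
      · rwa [hat]
    · rcases hb' with hbt | hbt
      · rw [hbt]
        exact D.symm hat
      · have he := D.edge hat
        have he' := D.edge hbt
        rw [D.tri hat hbt]
        rw [hpa] at he ⊢
        rw [hpb] at he' ⊢
        refine ⟨he.1, he'.1, fun hne => hab (by rw [hne]), Y.down_closed σ hσ _ ?_ (by simp)⟩
        simp [Finset.insert_subset_iff, ha, hb, hs (p t), ht]
  · by_contra hx0
    have hst := star_of_starLift_ne_zero hx0
    rw [starLift_apply hst, ← ne_eq, ← hs] at hx0
    obtain ⟨h₁, h₂⟩ := hl _ hx0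
    exact hx (Finset.mem_image.2 ⟨_, hx0, D.star_inj h₁ hst h₂⟩)
  · rw [Finset.sum_image hinj, ← h1]
    refine Finset.sum_congr rfl fun w hw => ?_
    rw [starLift_apply (hl w hw).1, (hl w hw).2]

theorem pushforward_starLift (hg : g ∈ Y.realization) (ht : g (p t) ≠ 0) :
    pushforward p (starLift A p t g) = g := by
  have hm := D.starLift_mem hg ht
  have ht' : starLift A p t g t ≠ 0 := by rwa [starLift_apply (.inl rfl)]
  ext w
  by_cases hw : g w = 0
  · rw [hw]
    by_contra H
    obtain ⟨x, rfl, hx⟩ := exists_of_pushforward_ne_zero H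
    rw [starLift_apply (star_of_starLift_ne_zero hx)] at hx
    exact hx hw
  · obtain ⟨x, hx, rfl⟩ := D.exists_lift_of_ne_zero hg ht hw
    rw [D.pushforward_of_star hm ht' hx, starLift_apply hx]

theorem starLift_pushforward (hh : h ∈ (cliqueComplex A).realization) (ht : h t ≠ 0) :
    starLift A p t (pushforward p h) = h := by
  ext x
  rw [starLift]
  split_ifs with hx
  · exact D.pushforward_of_star hh ht hx
  · by_contra hx0
    exact hx (star_of_ne_zero hh ht (Ne.symm hx0))

/-- The projection of realizations. -/
noncomputable def proj (hY : Y.SixLargeLinks) (h : (cliqueComplex A).realization) :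
    Y.realization := ⟨pushforward p h.1, D.pushforward_mem hY h.2⟩

theorem continuous_proj (hY : Y.SixLargeLinks) : Continuous (D.proj hY) := by
  refine Continuous.subtype_mk (continuous_pi fun w => ?_) _
  rw [continuous_iff_continuousAt]
  intro h
  obtain ⟨t, ht⟩ := exists_ne_zero h.2
  have hU := (isOpen_coord_ne_zero (cliqueComplex A) t).mem_nhds ht
  by_cases hw : ∃ x, (x = t ∨ A t x) ∧ p x = w
  · obtain ⟨x, hx, rfl⟩ := hw
    refine ((continuous_apply x).comp continuous_subtype_val).continuousAt.congr ?_
    filter_upwards [hU] with h' ht'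
    exact (D.pushforward_of_star h'.2 ht' hx).symm
  · refine (continuousAt_const (y := (0 : ℝ))).congr ?_
    filter_upwards [hU] with h' ht'
    by_contra H
    obtain ⟨x, hxw, hx⟩ := exists_of_pushforward_ne_zero (Ne.symm H)
    exact hw ⟨x, star_of_ne_zero h'.2 ht' hx, hxw⟩

theorem isCoveringMap_proj (hY : Y.SixLargeLinks) : IsCoveringMap (D.proj hY) := by
  intro g
  obtain ⟨v, hv⟩ := exists_ne_zero g.2
  let I := {t : T // p t = v}
  let : TopologicalSpace I := ⊥
  have : DiscreteTopology I := ⟨rfl⟩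
  let U : Set Y.realization := {g | g.1 v ≠ 0}
  have hU : IsOpen U := isOpen_coord_ne_zero Y v
  have hex : ∀ h : D.proj hY ⁻¹' U, ∃ t : I, h.1.1 t.1 ≠ 0 := fun h => by
    obtain ⟨x, hx, hx0⟩ := exists_of_pushforward_ne_zero h.2
    exact ⟨⟨x, hx⟩, hx0⟩
  choose sheet hsheet using hex
  have hsheet_eq : ∀ (h : D.proj hY ⁻¹' U) (t : I), h.1.1 t.1 ≠ 0 → sheet h = t := fun h t ht =>
    Subtype.ext (D.eq_of_ne_zero h.1.2 ht (hsheet h) ((sheet h).2.trans t.2.symm))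
  have hcont : Continuous sheet := by
    rw [continuous_discrete_rng]
    intro t
    convert ((isOpen_coord_ne_zero (cliqueComplex A) t.1).preimage
      (continuous_subtype_val : Continuous (Subtype.val : D.proj hY ⁻¹' U → _))) using 1
    ext h
    exact ⟨fun he => by rw [← (he : sheet h = t)]; exact hsheet h, hsheet_eq h t⟩
  have hmem : ∀ q : U × I, q.1.1.1 (p q.2.1) ≠ 0 := fun q => by
    rw [q.2.2]
    exact q.1.2
  have hproj : ∀ q : U × I,
      D.proj hY ⟨starLift A p q.2.1 q.1.1.1, D.starLift_mem q.1.1.2 (hmem q)⟩ = q.1.1 :=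
    fun q => Subtype.ext (D.pushforward_starLift q.1.1.2 (hmem q))
  refine (IsEvenlyCovered.to_isEvenlyCovered_preimage (I := I)
    ⟨inferInstance, U, hv, hU, hU.preimage (D.continuous_proj hY), ?_⟩)
  refine ⟨⟨⟨fun h => (⟨D.proj hY h.1, h.2⟩, sheet h),
    fun q => ⟨⟨starLift A p q.2.1 q.1.1.1, D.starLift_mem q.1.1.2 (hmem q)⟩, ?_⟩, ?_, ?_⟩, ?_, ?_⟩,
    fun _ => rfl⟩
  · rw [Set.mem_preimage, hproj]
    exact q.1.2
  · intro h
    exact Subtype.ext (Subtype.ext (D.starLift_pushforward h.1.2 (hsheet h)))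
  · intro q
    refine Prod.ext (Subtype.ext (hproj q)) (hsheet_eq _ _ ?_)
    change starLift A p q.2.1 q.1.1.1 q.2.1 ≠ 0
    rw [starLift_apply (.inl rfl)]
    exact hmem q
  · exact (((D.continuous_proj hY).comp continuous_subtype_val).subtype_mk _).prodMk hcont
  · refine ((continuous_pi fun x => ?_).subtype_mk _).subtype_mk _
    rw [continuous_prod_of_discrete_right]
    intro t
    simp only [starLift]
    split_ifs
    · exact (continuous_apply _).comp (continuous_subtype_val.comp continuous_subtype_val)
    · exact continuous_const

end Development

end Cover

section Support

variable {V : Type u} {Y : SComplex V}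

theorem finite_support_of_isCompact (hlf : Y.LocallyFinite) {K : Set Y.realization}
    (hK : IsCompact K) : {v | ∃ g ∈ K, g.1 v ≠ 0}.Finite := by
  obtain ⟨t, ht⟩ := hK.elim_finite_subcover (fun v => {g : Y.realization | g.1 v ≠ 0})
    (isOpen_coord_ne_zero Y) fun g _ => Set.mem_iUnion.2 (exists_ne_zero g.2)
  refine Set.Finite.subset (t.finite_toSet.biUnion fun v _ =>
    (hlf v).biUnion fun σ _ => σ.finite_toSet) ?_
  rintro w ⟨g, hg, hw⟩
  obtain ⟨v, hv, hgv⟩ := Set.mem_iUnion₂.1 (ht hg)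
  obtain ⟨σ, hσ, hs, -⟩ := exists_support g.2
  exact Set.mem_biUnion hv (Set.mem_biUnion (⟨hσ, (hs v).2 hgv⟩ : σ ∈ {σ ∈ Y.faces | v ∈ σ})
    ((hs w).2 hw))

end Support

section Contraction

variable {V : Type u} [DecidableEq V] {Y : SComplex V} {T : Type u} [LinearOrder T]
  {A : T → T → Prop} {p : T → V} {f : T → T} {o : T} {h : T → ℝ} {t w : T}

namespace Development

/-- Move the barycentric weight `s * h w` from `w` to `f w`. -/
def push (f : T → T) (w : T) (s : ℝ) (h : T → ℝ) (t : T) : ℝ :=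
  h t + s * h w * ((if t = f w then 1 else 0) - if t = w then 1 else 0)

theorem push_mem (D : Y.Development A p f o) (hw : w ≠ o)
    (hh : h ∈ (cliqueComplex A).realization) (hle : ∀ t, h t ≠ 0 → t ≤ w) {s : ℝ} (hs0 : 0 ≤ s)
    (hs1 : s ≤ 1) : push f w s h ∈ (cliqueComplex A).realization := by
  by_cases h0 : h w = 0
  · convert hh using 1
    ext t
    simp [push, h0]
  obtain ⟨σ, hσ, hs, h1⟩ := exists_support hh
  have hfw := D.f_lt hw
  have hwσ := (hs w).2 h0
  refine ⟨fun t => ?_, insert (f w) σ, ⟨by simp, ?_⟩, fun t ht => ?_, ?_⟩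
  · have h₁ := hh.1 t
    have h₂ := mul_nonneg hs0 (hh.1 w)
    rw [push]
    split_ifs with h₃ h₄ h₄
    · exact absurd (h₄.symm.trans h₃) hfw.ne'
    · linarith
    · subst h₄
      nlinarith [hh.1 t]
    · linarith
  · have key : ∀ a ∈ σ, a ≠ f w → A a (f w) := by
      intro a ha hne
      by_cases haw : a = w
      · rw [haw]
        exact D.adj_f hw
      · exact (D.dominated hw (hσ.2 a ha w hwσ haw)
          ((hle a ((hs a).1 ha)).lt_of_ne haw)).resolve_left hne
    intro a ha b hb hab
    rcases Finset.mem_insert.1 ha with rfl | ha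
    · exact D.symm (key b ((Finset.mem_insert.1 hb).resolve_left hab.symm) hab.symm)
    · rcases Finset.mem_insert.1 hb with rfl | hb
      · exact key a ha hab
      · exact hσ.2 a ha b hb hab
  · rw [Finset.mem_insert, not_or] at ht
    have h₁ : h t = 0 := by_contra fun h => ht.2 ((hs t).2 h)
    have h₂ : t ≠ w := by rintro rfl; exact h0 h₁
    simp [push, h₁, h₂, ht.1]
  · have h₁ : ∑ t ∈ insert (f w) σ, h t = 1 := by
      rw [← h1]
      refine Finset.sum_insert_of_eq_zero_if_notMem fun hf => by_contra fun h => hf ((hs _).2 h)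
    simp only [push, Finset.sum_add_distrib, h₁, ← Finset.mul_sum, Finset.sum_sub_distrib]
    simp [hwσ]

theorem of_push_ne_zero (D : Y.Development A p f o) (hw : w ≠ o)
    (ht : push f w 1 h t ≠ 0) : t ≠ w ∧ (h t ≠ 0 ∨ t = f w) := by
  have hfw := D.f_lt hw
  constructor
  · rintro rfl
    simp [push, hfw.ne'] at ht
  · by_contra! H
    have h₂ : t ≠ w := by
      rintro rfl
      simp [push, hfw.ne'] at ht
    simp [push, H.1, H.2, h₂] at ht

theorem locallyFinite (D : Y.Development A p f o) (hlf : Y.LocallyFinite) :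
    (cliqueComplex A).LocallyFinite := by
  intro t
  have h₁ : {w | Y.Edge (p t) w}.Finite := by
    refine ((hlf (p t)).biUnion fun σ _ => σ.finite_toSet).subset fun w hw => ?_
    exact Set.mem_biUnion
      (⟨hw.2, by simp⟩ : {p t, w} ∈ {σ ∈ Y.faces | p t ∈ σ}) (by simp)
  have h₂ : {x | A t x}.Finite :=
    Set.Finite.of_finite_image (h₁.subset (Set.image_subset_iff.2 fun x hx => D.edge hx))
      fun a ha b hb he => D.inj ha hb he
  have h₃ := (h₂.insert t).finite_subsets
  refine Set.Finite.of_finite_image (h₃.subset ?_) (Finset.coe_injective.injOn (s := _))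
  rintro _ ⟨σ, ⟨hσ, ht⟩, rfl⟩ x hx
  by_cases hxt : x = t
  · exact .inl hxt
  · exact .inr (hσ.2 t ht x hx (Ne.symm hxt))

variable {S : Type*} [TopologicalSpace S]

theorem exists_homotopic_const_of_finset [WellFoundedLT T] (D : Y.Development A p f o) (w : T) :
    ∀ (s : Finset T) (F : C(S, (cliqueComplex A).realization)), (∀ t ∈ s, t ≤ w) →
      (∀ x t, (F x).1 t ≠ 0 → t ∈ s) →
      ∃ e, ContinuousMap.Homotopic F (ContinuousMap.const S e) := by
  induction w using WellFoundedLT.induction with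
  | ind w ih =>
  intro s F hsw hF
  by_cases hw : w = o
  · subst hw
    have hmin : ∀ t, t ≤ w → t = w := by
      intro t
      induction t using WellFoundedLT.induction with
      | ind t ih' =>
        intro htw
        by_contra hne
        have hft := D.f_lt hne
        have := ih' _ hft (hft.le.trans htw)
        exact (hft.trans_le htw).ne this
    have hz : ∀ x t, t ≠ w → (F x).1 t = 0 := fun x t ht =>
      by_contra fun h => ht (hmin t (hsw t (hF x t h)))
    have hval : ∀ x, (F x).1 w = 1 := fun x => by
      obtain ⟨σ, hσ, hs, h1⟩ := exists_support (F x).2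
      have : σ = {w} := Finset.eq_singleton_iff_nonempty_unique_mem.2
        ⟨hσ.1, fun t ht => by_contra fun h => (hs t).1 ht (hz x t h)⟩
      rwa [this, Finset.sum_singleton] at h1
    rcases isEmpty_or_nonempty S with hS | ⟨⟨x₀⟩⟩
    · refine ⟨⟨Pi.single w 1, ?_⟩, ?_⟩
      · refine ⟨fun t => ?_, {w}, ⟨by simp, by simp⟩, fun t ht => ?_, by simp⟩
        · by_cases ht : t = w <;> simp [ht]
        · simp at ht
          simp [ht]
      · convert ContinuousMap.Homotopic.refl F
        ext x
        exact hS.elim x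
    · refine ⟨F x₀, ?_⟩
      convert ContinuousMap.Homotopic.refl F
      ext x t
      by_cases ht : t = w
      · subst ht
        simp [hval]
      · simp [hz _ t ht]
  have hle : ∀ x t, (F x).1 t ≠ 0 → t ≤ w := fun x t h => hsw t (hF x t h)
  let H : C(unitInterval × S, (cliqueComplex A).realization) :=
    ⟨fun q => ⟨push f w q.1 (F q.2).1, D.push_mem hw (F q.2).2 (hle q.2) q.1.2.1 q.1.2.2⟩, by
      refine Continuous.subtype_mk (continuous_pi fun t => ?_) _
      have hc : ∀ t, Continuous fun q : unitInterval × S => (F q.2).1 t := fun t =>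
        (continuous_apply t).comp (continuous_subtype_val.comp (F.continuous.comp continuous_snd))
      exact (hc t).add (((continuous_subtype_val.comp continuous_fst).mul (hc w)).mul
        continuous_const)⟩
  let F' : C(S, (cliqueComplex A).realization) := H.comp ((ContinuousMap.const S 1).prodMk (.id S))
  have hFF' : F.Homotopic F' := by
    refine ⟨⟨H, fun x => ?_, fun x => rfl⟩⟩
    refine Subtype.ext (funext fun t => ?_)
    simp [H, push]
  have hne : (insert (f w) (s.erase w)).Nonempty := by simp
  have hlt : (insert (f w) (s.erase w)).max' hne < w := by
    rw [Finset.max'_lt_iff]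
    intro t ht
    rcases Finset.mem_insert.1 ht with rfl | ht
    · exact D.f_lt hw
    · exact (hsw t (Finset.mem_of_mem_erase ht)).lt_of_ne (Finset.ne_of_mem_erase ht)
  have hF' : ∀ x t, (F' x).1 t ≠ 0 → t ∈ insert (f w) (s.erase w) := by
    intro x t ht
    obtain ⟨h₁, h₂⟩ := D.of_push_ne_zero hw (h := (F x).1) ht
    rw [Finset.mem_insert, Finset.mem_erase]
    exact h₂.symm.imp_right fun h => ⟨h₁, hF x t h⟩
  obtain ⟨e, he⟩ := ih _ hlt _ F' (fun t ht => Finset.le_max' _ t ht) hF'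
  exact ⟨e, hFF'.trans he⟩

theorem exists_homotopic_const [WellFoundedLT T] [CompactSpace S] (D : Y.Development A p f o)
    (hlf : Y.LocallyFinite) (F : C(S, (cliqueComplex A).realization)) :
    ∃ e, ContinuousMap.Homotopic F (ContinuousMap.const S e) := by
  have hfin := finite_support_of_isCompact (D.locallyFinite hlf) (isCompact_range F.continuous)
  refine D.exists_homotopic_const_of_finset ((insert o hfin.toFinset).max' (by simp))
    (insert o hfin.toFinset) F (fun t ht => Finset.le_max' _ t ht) fun x t ht => ?_
  simp only [Finset.mem_insert, Set.Finite.mem_toFinset]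
  exact .inr ⟨F x, ⟨x, rfl⟩, ht⟩

end Development

end Contraction

end SComplex

section Sphere

open Metric unitInterval Module

variable {H : Type*} [NormedAddCommGroup H] [InnerProductSpace ℝ H]

/-- The parametrization of the unit sphere by the meridians joining `e` to `-e`. -/
noncomputable def meridian (e : H) (q : I × sphere (0 : (ℝ ∙ e)ᗮ) 1) : H :=
  Real.cos (Real.pi * q.1) • e + Real.sin (Real.pi * q.1) • (q.2 : H)

variable {e : H}

theorem inner_meridian (he : ‖e‖ = 1) (q : I × sphere (0 : (ℝ ∙ e)ᗮ) 1) :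
    inner ℝ e (meridian e q) = Real.cos (Real.pi * q.1) := by
  have h₁ : inner ℝ e (q.2 : H) = 0 := Submodule.mem_orthogonal_singleton_iff_inner_right.1 q.2.1.2
  simp [meridian, inner_add_right, inner_smul_right, h₁, he]

theorem norm_meridian (he : ‖e‖ = 1) (q : I × sphere (0 : (ℝ ∙ e)ᗮ) 1) : ‖meridian e q‖ = 1 := by
  have h₁ : inner ℝ e (q.2 : H) = 0 := Submodule.mem_orthogonal_singleton_iff_inner_right.1 q.2.1.2
  have h₂ : ‖(q.2 : H)‖ = 1 := mem_sphere_zero_iff_norm.1 q.2.2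
  rw [← sq_eq_sq₀ (norm_nonneg _) zero_le_one, meridian, norm_add_sq_real]
  simp [norm_smul, inner_smul_left, inner_smul_right, h₁, h₂, he]

theorem continuous_meridian : Continuous (meridian e) := by
  unfold meridian
  fun_prop

theorem exists_meridian_eq [Nonempty (sphere (0 : (ℝ ∙ e)ᗮ) 1)] (he : ‖e‖ = 1) {x : H}
    (hx : ‖x‖ = 1) : ∃ q, meridian e q = x := by
  set c := inner ℝ e x with hc
  have hc' : |c| ≤ 1 := by simpa [he, hx] using abs_real_inner_le_norm e x
  have hpi := Real.pi_pos
  let t : I := ⟨Real.arccos c / Real.pi, by have := Real.arccos_nonneg c; positivity,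
    (div_le_one hpi).2 (Real.arccos_le_pi c)⟩
  have ht : Real.pi * t = Real.arccos c := mul_div_cancel₀ _ hpi.ne'
  have hy : x - c • e ∈ (ℝ ∙ e)ᗮ := by
    rw [Submodule.mem_orthogonal_singleton_iff_inner_right, inner_sub_right, inner_smul_right]
    simp [he, hc]
  have hsin : Real.sin (Real.arccos c) = ‖x - c • e‖ := by
    rw [Real.sin_arccos, Real.sqrt_eq_iff_eq_sq (by nlinarith [abs_le.1 hc']) (norm_nonneg _),
      norm_sub_sq_real, norm_smul, inner_smul_right, real_inner_comm, ← hc, hx, he]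
    simp
    ring
  have hcos : Real.cos (Real.arccos c) = c := Real.cos_arccos (abs_le.1 hc').1 (abs_le.1 hc').2
  by_cases h0 : x - c • e = 0
  · obtain ⟨a⟩ := ‹Nonempty (sphere (0 : (ℝ ∙ e)ᗮ) 1)›
    refine ⟨(t, a), ?_⟩
    rw [meridian, ht, hsin, hcos, h0]
    simp [← sub_eq_zero.1 h0]
  · have hn : ‖x - c • e‖ ≠ 0 := norm_ne_zero_iff.2 h0
    refine ⟨(t, ⟨⟨‖x - c • e‖⁻¹ • (x - c • e), Submodule.smul_mem _ _ hy⟩, ?_⟩), ?_⟩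
    · simp [norm_smul, hn]
    · rw [meridian, ht, hsin, hcos]
      simp [smul_smul, hn]

theorem meridian_eq_iff (he : ‖e‖ = 1) {q r : I × sphere (0 : (ℝ ∙ e)ᗮ) 1}
    (h : meridian e q = meridian e r) : q.1 = r.1 ∧ (q.1 = 0 ∨ q.1 = 1 ∨ q.2 = r.2) := by
  have hpi := Real.pi_pos
  have hmem : ∀ t : I, Real.pi * t ∈ Set.Icc 0 Real.pi := fun t =>
    ⟨mul_nonneg hpi.le t.2.1, mul_le_of_le_one_right hpi.le t.2.2⟩
  have h₁ : q.1 = r.1 := by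
    have := congrArg (inner ℝ e) h
    rw [inner_meridian he, inner_meridian he] at this
    exact Subtype.ext (mul_left_cancel₀ hpi.ne' (Real.injOn_cos (hmem _) (hmem _) this))
  refine ⟨h₁, ?_⟩
  by_cases h0 : q.1 = 0
  · exact .inl h0
  by_cases h1 : q.1 = 1
  · exact .inr (.inl h1)
  refine .inr (.inr ?_)
  have hpos : 0 < Real.pi * q.1 :=
    mul_pos hpi (lt_of_le_of_ne q.1.2.1 fun h => h0 (Subtype.ext h.symm))
  have hlt : Real.pi * q.1 < Real.pi :=
    mul_lt_of_lt_one_right hpi (lt_of_le_of_ne q.1.2.2 fun h => h1 (Subtype.ext h))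
  rw [meridian, meridian, ← h₁, add_right_inj] at h
  have hsin := (Real.sin_pos_of_pos_of_lt_pi hpos hlt).ne'
  exact Subtype.ext (Subtype.ext (smul_right_injective H hsin h))

/-- A map from a sphere of dimension at least two lifts through a covering map. -/
theorem IsCoveringMap.exists_lift_sphere [FiniteDimensional ℝ H] (hdim : 2 < finrank ℝ H)
    {E B : Type*} [TopologicalSpace E] [TopologicalSpace B] {p : E → B} (hp : IsCoveringMap p)
    (he : ‖e‖ = 1) (f : C(sphere (0 : H) 1, B)) {z : E} (hz : p z = f ⟨e, by simpa⟩) :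
    ∃ F : C(sphere (0 : H) 1, E), ∀ x, p (F x) = f x := by
  have hrank : 1 < Module.rank ℝ (ℝ ∙ e)ᗮ := by
    have hdim' : Fact (finrank ℝ H = (finrank ℝ H - 1) + 1) := ⟨by omega⟩
    have h₁ := Submodule.finrank_orthogonal_span_singleton (𝕜 := ℝ) (n := finrank ℝ H - 1) (v := e)
      (by rw [← norm_ne_zero_iff, he]; exact one_ne_zero)
    rw [← finrank_eq_rank, h₁]
    exact_mod_cast (by omega : 1 < finrank ℝ H - 1)
  have hconn := isConnected_sphere hrank (0 : (ℝ ∙ e)ᗮ) zero_le_one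
  have : ConnectedSpace (sphere (0 : (ℝ ∙ e)ᗮ) 1) := isConnected_iff_connectedSpace.1 hconn
  have : CompactSpace (sphere (0 : (ℝ ∙ e)ᗮ) 1) :=
    isCompact_iff_compactSpace.1 (isCompact_sphere _ _)
  let q : C(I × sphere (0 : (ℝ ∙ e)ᗮ) 1, sphere (0 : H) 1) :=
    ⟨fun r => ⟨meridian e r, mem_sphere_zero_iff_norm.2 (norm_meridian he r)⟩,
      continuous_meridian.subtype_mk _⟩
  have hq : Topology.IsQuotientMap q := by
    refine q.continuous.isClosedMap.isQuotientMap q.continuous fun x => ?_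
    obtain ⟨r, hr⟩ := exists_meridian_eq he (mem_sphere_zero_iff_norm.1 x.2)
    exact ⟨r, Subtype.ext hr⟩
  have hq0 : ∀ a, q (0, a) = ⟨e, by simpa⟩ := fun a => Subtype.ext (by simp [q, meridian])
  have hq1 : ∀ a b, q (1, a) = q (1, b) := fun a b => Subtype.ext (by simp [q, meridian])
  have h0 : ∀ a, (f.comp q) (0, a) = p (ContinuousMap.const (sphere (0 : (ℝ ∙ e)ᗮ) 1) z a) :=
    fun a => by simp [hq0, hz]
  let G := hp.liftHomotopy (f.comp q) (ContinuousMap.const _ z) h0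
  have hG : ∀ r, p (G r) = f (q r) := fun r => congrFun (hp.liftHomotopy_lifts _ _ h0) r
  have hG0 : ∀ a, G (0, a) = z := fun a => hp.liftHomotopy_zero _ _ h0 a
  have hG1 : ∀ a b, G (1, a) = G (1, b) := by
    refine hp.const_of_comp (g := fun a => G (1, a)) (by fun_prop) fun a b => ?_
    rw [hG, hG, hq1 a b]
  have hfib : ∀ r s, q r = q s → G r = G s := by
    rintro ⟨t, a⟩ ⟨t', b⟩ hrs
    obtain ⟨h₁, h₂⟩ := meridian_eq_iff he (congrArg Subtype.val hrs)
    simp only at h₁ h₂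
    subst h₁
    rcases h₂ with rfl | rfl | rfl
    · rw [hG0, hG0]
    · exact hG1 a b
    · rfl
  refine ⟨hq.lift G hfib, fun x => ?_⟩
  obtain ⟨r, rfl⟩ := hq.surjective x
  have := congrArg (fun φ => φ r) (hq.lift_comp G hfib)
  simp only [ContinuousMap.comp_apply] at this
  rw [this, hG]

/-- A null-homotopic map from the sphere extends to the ball. -/
theorem ContinuousMap.Homotopic.exists_extension_closedBall [FiniteDimensional ℝ H] (he : ‖e‖ = 1)
    {B : Type*} [TopologicalSpace B] {f : C(sphere (0 : H) 1, B)} {b : B}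
    (hf : f.Homotopic (ContinuousMap.const _ b)) :
    ∃ g : C(closedBall (0 : H) 1, B), ∀ x : sphere (0 : H) 1,
      g ⟨x, sphere_subset_closedBall x.2⟩ = f x := by
  obtain ⟨G⟩ := hf
  have : CompactSpace (sphere (0 : H) 1) := isCompact_iff_compactSpace.1 (isCompact_sphere _ _)
  have hnorm : ∀ x : sphere (0 : H) 1, ‖(x : H)‖ = 1 := fun x => mem_sphere_zero_iff_norm.1 x.2
  have hn : ∀ r : I × sphere (0 : H) 1, ‖(1 - (r.1 : ℝ)) • (r.2 : H)‖ = 1 - r.1 := fun r => by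
    rw [norm_smul, hnorm, mul_one, Real.norm_of_nonneg (sub_nonneg.2 r.1.2.2)]
  let q : C(I × sphere (0 : H) 1, closedBall (0 : H) 1) :=
    ⟨fun r => ⟨(1 - (r.1 : ℝ)) • (r.2 : H), by
      rw [mem_closedBall_zero_iff, hn]
      linarith [r.1.2.1]⟩, by fun_prop⟩
  have hq : Topology.IsQuotientMap q := by
    refine q.continuous.isClosedMap.isQuotientMap q.continuous fun x => ?_
    by_cases hx : (x : H) = 0
    · refine ⟨(1, ⟨e, by simpa⟩), Subtype.ext ?_⟩
      simp [q, hx]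
    · have hx' : ‖(x : H)‖ ≠ 0 := norm_ne_zero_iff.2 hx
      have hx1 : ‖(x : H)‖ ≤ 1 := mem_closedBall_zero_iff.1 x.2
      refine ⟨(⟨1 - ‖(x : H)‖, by linarith, by linarith [norm_nonneg (x : H)]⟩,
        ⟨‖(x : H)‖⁻¹ • (x : H), by simp [norm_smul, hx']⟩), Subtype.ext ?_⟩
      simp [q, smul_smul, hx']
  have hfib : ∀ r s, q r = q s → G.toContinuousMap r = G.toContinuousMap s := by
    rintro ⟨t, x⟩ ⟨t', y⟩ hrs
    have hrs' : (1 - (t : ℝ)) • (x : H) = (1 - (t' : ℝ)) • (y : H) := congrArg Subtype.val hrs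
    have h₁ : t = t' := by
      have := congrArg norm hrs'
      rw [hn (t, x), hn (t', y)] at this
      exact Subtype.ext (by simpa using this)
    subst h₁
    by_cases ht : t = 1
    · subst ht
      exact (G.apply_one x).trans (G.apply_one y).symm
    · have : 1 - (t : ℝ) ≠ 0 := sub_ne_zero.2 fun h => ht (Subtype.ext h.symm)
      rw [Subtype.ext (smul_right_injective H this hrs')]
  refine ⟨hq.lift G.toContinuousMap hfib, fun x => ?_⟩
  have h₁ := congrArg (fun φ => φ (0, x)) (hq.lift_comp G.toContinuousMap hfib)
  have h₂ : q (0, x) = ⟨x, sphere_subset_closedBall x.2⟩ := Subtype.ext (by simp [q])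
  simp only [ContinuousMap.comp_apply] at h₁
  rw [← h₂, h₁]
  exact G.apply_zero x

end Sphere

namespace SComplex

open Metric Module

section Extension

variable {V : Type u} [DecidableEq V] {Y : SComplex V} {H : Type*} [NormedAddCommGroup H]
  [InnerProductSpace ℝ H]

/-- Spheres of dimension at least two are null-homotopic in locally finite, locally `6`-large
complexes. -/
theorem SixLargeLinks.exists_extension_closedBall [FiniteDimensional ℝ H] (hY : Y.SixLargeLinks)
    (hlf : Y.LocallyFinite) (hdim : 2 < finrank ℝ H)
    (f : C(Metric.sphere (0 : H) 1, Y.realization)) :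
    ∃ g : C(closedBall (0 : H) 1, Y.realization), ∀ x : Metric.sphere (0 : H) 1,
      g ⟨x, sphere_subset_closedBall x.2⟩ = f x := by
  have : Nontrivial H := Module.nontrivial_of_finrank_pos (R := ℝ) (by omega)
  obtain ⟨e, he⟩ := exists_norm_eq H zero_le_one
  let e' : Metric.sphere (0 : H) 1 := ⟨e, by simpa⟩
  obtain ⟨v₀, hv₀⟩ := exists_ne_zero (f e').2
  obtain ⟨σ, hσ, hs, -⟩ := exists_support (f e').2
  have hface : {v₀} ∈ Y.faces := Y.down_closed σ hσ _ (by simp [hs, hv₀]) (by simp)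
  obtain ⟨T, _, A, p, φ, o, _, rfl, D⟩ := hY.exists_development hface
  obtain ⟨F, hF⟩ := (D.isCoveringMap_proj hY).exists_lift_sphere hdim he f
    (z := ⟨starLift A p o (f e').1, D.starLift_mem (f e').2 hv₀⟩)
    (Subtype.ext (D.pushforward_starLift (f e').2 hv₀))
  have : CompactSpace (Metric.sphere (0 : H) 1) :=
    isCompact_iff_compactSpace.1 (isCompact_sphere _ _)
  obtain ⟨b, hb⟩ := D.exists_homotopic_const hlf F
  let P : C((cliqueComplex A).realization, Y.realization) := ⟨D.proj hY, D.continuous_proj hY⟩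
  have hf : f = P.comp F := ContinuousMap.ext fun x => (hF x).symm
  have hhom : f.Homotopic (ContinuousMap.const _ (P b)) := by
    rw [hf]
    exact (ContinuousMap.Homotopic.refl P).comp hb
  exact hhom.exists_extension_closedBall he

end Extension

section ClosedSimplex

variable {V : Type u} {X : SComplex V}

theorem isCompact_closedSimplex {τ : Finset V} (hτ : τ ∈ X.faces) :
    IsCompact {g : X.realization | ∀ v ∉ τ, g.1 v = 0} := by
  rw [Topology.IsInducing.subtypeVal.isCompact_iff]
  have himage : Subtype.val '' {g : X.realization | ∀ v ∉ τ, g.1 v = 0} =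
      Set.univ.pi (fun _ => Set.Icc 0 1) ∩
        ((⋂ v ∈ {v | v ∉ τ}, {g : V → ℝ | g v = 0}) ∩ {g | ∑ v ∈ τ, g v = 1}) := by
    ext g
    simp only [Set.mem_image, Set.mem_ofPred_eq, Subtype.exists, exists_and_left, exists_prop,
      exists_eq_right_right, Set.mem_inter_iff, Set.mem_pi, Set.mem_univ, forall_const,
      Set.mem_Icc, Set.mem_iInter]
    constructor
    · rintro ⟨h0, hg⟩
      have hsum : ∑ v ∈ τ, g v = 1 := by
        obtain ⟨σ, -, hs, h1⟩ := exists_support hg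
        rw [← h1]
        refine (Finset.sum_subset (fun v hv => ?_) fun v _ hv => ?_).symm
        · by_contra h
          exact (hs v).1 hv (h0 v h)
        · exact by_contra fun h => hv ((hs v).2 h)
      refine ⟨fun v => ⟨hg.1 v, ?_⟩, h0, hsum⟩
      by_cases hv : v ∈ τ
      · rw [← hsum]
        exact Finset.single_le_sum (fun w _ => hg.1 w) hv
      · rw [h0 v hv]
        exact zero_le_one
    · rintro ⟨hb, h0, h1⟩
      exact ⟨h0, fun v => (hb v).1, τ, hτ, h0, h1⟩
  rw [himage]
  refine (isCompact_univ_pi fun _ => isCompact_Icc).inter_right (IsClosed.inter ?_ ?_)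
  · exact isClosed_biInter fun v _ => isClosed_eq (continuous_apply v) continuous_const
  · exact isClosed_eq (continuous_finsetSum _ fun v _ => continuous_apply v) continuous_const

end ClosedSimplex

section Restrict

variable {V : Type u} {X : SComplex V} {W : Set V} {g : V → ℝ}

theorem realization_restrict_subset : (X.restrict W).realization ⊆ X.realization :=
  fun _ ⟨h0, σ, hσ, h1⟩ => ⟨h0, σ, hσ.1, h1⟩

theorem mem_of_mem_realization_restrict (hg : g ∈ (X.restrict W).realization) {v : V}
    (hv : g v ≠ 0) : v ∈ W := by
  obtain ⟨-, σ, hσ, h0, -⟩ := hg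
  exact hσ.2 v (by_contra fun h => hv (h0 v h))

theorem mem_realization_restrict (hg : g ∈ X.realization) (hW : ∀ v, g v ≠ 0 → v ∈ W) :
    g ∈ (X.restrict W).realization := by
  obtain ⟨σ, hσ, hs, h1⟩ := exists_support hg
  exact ⟨hg.1, σ, ⟨hσ, fun v hv => hW v ((hs v).1 hv)⟩, fun v hv => by_contra fun h =>
    hv ((hs v).2 h), h1⟩

theorem LocallyFinite.restrict (h : X.LocallyFinite) (W : Set V) :
    (X.restrict W).LocallyFinite :=
  fun v => (h v).subset fun _ hσ => ⟨hσ.1.1, hσ.2⟩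

end Restrict

end SComplex

/-- **Theorem (Osajda, Theorem 3.1, first part).** Let `X` be a locally finite
systolic simplicial complex and let `k ≥ 2` be a natural number. Then the condition
`Conn_k^∞(X)` holds. -/
theorem connInfty_of_locallyFinite_systolic {V : Type} [DecidableEq V]
    (X : SComplex V) (hlf : X.LocallyFinite) (hsys : X.Systolic)
    (k : ℕ) (hk : 2 ≤ k) :
    ConnInfty X.realization (k : ℤ) := by
  intro K hK
  have hF := SComplex.finite_support_of_isCompact hlf hK
  set F : Set V := {v | ∃ g ∈ K, g.1 v ≠ 0} with hFdef
  have hfin : {τ | τ ∈ X.faces ∧ ∃ v ∈ F, v ∈ τ}.Finite := by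
    refine (hF.biUnion fun v _ => hlf v).subset ?_
    rintro τ ⟨hτ, v, hv, hvτ⟩
    exact Set.mem_biUnion hv ⟨hτ, hvτ⟩
  have hL : ∀ g : X.realization, ∀ v ∈ F, g.1 v ≠ 0 →
      g ∈ ⋃ τ ∈ {τ | τ ∈ X.faces ∧ ∃ v ∈ F, v ∈ τ}, {g : X.realization | ∀ v ∉ τ, g.1 v = 0} := by
    intro g v hv hgv
    obtain ⟨σ, hσ, hs, -⟩ := SComplex.exists_support g.2
    exact Set.mem_biUnion (⟨hσ, v, hv, (hs v).2 hgv⟩ : σ ∈ {τ | τ ∈ X.faces ∧ ∃ v ∈ F, v ∈ τ})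
      fun w hw => by_contra fun h => hw ((hs w).2 h)
  refine ⟨_, hfin.isCompact_biUnion fun τ hτ => SComplex.isCompact_closedSimplex hτ.1,
    fun g hg => ?_, ?_⟩
  · obtain ⟨v, hv⟩ := SComplex.exists_ne_zero g.2
    exact hL g v ⟨g, hg, hv⟩ hv
  intro f hf hfL
  have hmem : ∀ x ∈ Metric.sphere 0 1, (f x).1 ∈ (X.restrict Fᶜ).realization := fun x hx =>
    SComplex.mem_realization_restrict (f x).2 fun v hv hvF => hfL x hx (hL _ v hvF hv)
  let f' : C(Metric.sphere (0 : EuclideanSpace ℝ (Fin ((k : ℤ) + 1).toNat)) 1,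
      (X.restrict Fᶜ).realization) :=
    ⟨fun x => ⟨(f x).1, hmem x x.2⟩,
      (continuous_subtype_val.comp (continuousOn_iff_continuous_domRestrict.1 hf)).subtype_mk _⟩
  obtain ⟨g, hg⟩ := (hsys.1.sixLargeLinks.restrict Fᶜ).exists_extension_closedBall
    (hlf.restrict Fᶜ) (by rw [finrank_euclideanSpace_fin]; omega) f'
  classical
  let G : EuclideanSpace ℝ (Fin ((k : ℤ) + 1).toNat) → X.realization := fun x =>
    if hx : x ∈ Metric.closedBall 0 1 then
      ⟨(g ⟨x, hx⟩).1, SComplex.realization_restrict_subset (g ⟨x, hx⟩).2⟩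
    else f x
  have hG : ∀ x (hx : x ∈ Metric.closedBall 0 1), (G x).1 = (g ⟨x, hx⟩).1 := fun x hx => by
    simp only [G, dif_pos hx]
  refine ⟨G, ?_, fun x hx hxK => ?_, fun x hx => ?_⟩
  · rw [continuousOn_iff_continuous_domRestrict, Topology.IsInducing.subtypeVal.continuous_iff]
    convert continuous_subtype_val.comp g.continuous using 1
    ext1 x
    exact hG x.1 x.2
  · obtain ⟨v, hv⟩ := SComplex.exists_ne_zero (G x).2
    refine SComplex.mem_of_mem_realization_restrict (g ⟨x, hx⟩).2 (v := v) ?_ ⟨G x, hxK, hv⟩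
    rwa [← hG x hx]
  · refine Subtype.ext ?_
    rw [hG x (Metric.sphere_subset_closedBall hx), hg ⟨x, hx⟩]
    rfl
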